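/- arXiv:2110.09931 — 7 statements merged into one kernel-verified Lean document; each statement's English description precedes it below -/
import Mathlib

section
/- Let G be a connected simple graph with n vertices and Laplacian eigenvalues 0 = λ_1 < λ_2 ≤ ... ≤ λ_n. Then BH(G) ≤ (1/λ_2 + 1/λ_n)·Kf(G) − n(n−1)/(λ_2·λ_n), with equality if and only if there exists r ∈ {2, ..., n} such that λ_2 = ... = λ_r and λ_{r+1} = ... = λ_n. -/
open Finset Polynomial

/-- The eigenvalues of the Laplacian matrix of `G` over `ℝ`, as produced (in no
particular order) by the spectral theorem for symmetric matrices. -/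
noncomputable def lapEigsUnordered {V : Type*} [Fintype V] [DecidableEq V]
    (G : SimpleGraph V) [DecidableRel G.Adj] : V → ℝ :=
  (SimpleGraph.posSemidef_lapMatrix (R := ℝ) (G := G)).1.eigenvalues

/-- `μ : Fin n → ℝ` lists the eigenvalues of the Laplacian matrix of `G`
in nondecreasing order (so, `0`-based, `μ ⟨0,_⟩ = λ₁ ≤ μ ⟨1,_⟩ = λ₂ ≤ ⋯`). -/
def IsLapEigSeq {V : Type*} [Fintype V] [DecidableEq V] (G : SimpleGraph V)
    [DecidableRel G.Adj] {n : ℕ} (μ : Fin n → ℝ) : Prop :=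
  Monotone μ ∧ ∃ e : V ≃ Fin n, ∀ v, lapEigsUnordered G v = μ (e v)

theorem one_div_inj_aux {x y : ℝ} (h : 1 / x = 1 / y) : x = y := by
  simpa using h

theorem statement_5 {n : ℕ} (hn : 2 ≤ n) (G : SimpleGraph (Fin n)) [DecidableRel G.Adj]
    (hG : G.Connected) (μ : Fin n → ℝ) (hμ : IsLapEigSeq G μ)
    (hμ1 : μ ⟨0, by omega⟩ = 0) (hμ2 : 0 < μ ⟨1, by omega⟩) :
    (n : ℝ) * ∑ i ∈ univ.filter (fun i : Fin n => 0 < i.val), 1 / μ i ^ 2 ≤ (1 / μ ⟨1, by omega⟩ + 1 / μ ⟨n - 1, by omega⟩) * ((n : ℝ) * ∑ i ∈ univ.filter (fun i : Fin n => 0 < i.val), 1 / μ i) - (n : ℝ) * ((n : ℝ) - 1) / (μ ⟨1, by omega⟩ * μ ⟨n - 1, by omega⟩) ∧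
    ((n : ℝ) * ∑ i ∈ univ.filter (fun i : Fin n => 0 < i.val), 1 / μ i ^ 2 = (1 / μ ⟨1, by omega⟩ + 1 / μ ⟨n - 1, by omega⟩) * ((n : ℝ) * ∑ i ∈ univ.filter (fun i : Fin n => 0 < i.val), 1 / μ i) - (n : ℝ) * ((n : ℝ) - 1) / (μ ⟨1, by omega⟩ * μ ⟨n - 1, by omega⟩) ↔
      ∃ r : ℕ, 2 ≤ r ∧ r ≤ n ∧
        (∀ i : Fin n, 2 ≤ i.val + 1 → i.val + 1 ≤ r → μ i = μ ⟨1, by omega⟩) ∧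
        (∀ i : Fin n, r + 1 ≤ i.val + 1 → μ i = μ ⟨n - 1, by omega⟩)) := by
  have hmono := hμ.1
  clear hμ hG hμ1
  have key : ∀ (a b : ℝ), a = μ ⟨1, by omega⟩ → b = μ ⟨n - 1, by omega⟩ →
      (1 / a + 1 / b) * ((n : ℝ) * ∑ i ∈ univ.filter (fun i : Fin n => 0 < i.val), 1 / μ i)
        - (n : ℝ) * ((n : ℝ) - 1) / (a * b)
        - (n : ℝ) * ∑ i ∈ univ.filter (fun i : Fin n => 0 < i.val), 1 / μ i ^ 2
      = (n : ℝ) * ∑ i ∈ univ.filter (fun i : Fin n => 0 < i.val),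
          (1 / a - 1 / μ i) * (1 / μ i - 1 / b) := by
    intro a b _ _
    have hcard : ((univ.filter (fun i : Fin n => 0 < i.val)).card : ℝ) = (n : ℝ) - 1 := by
      have h : univ.filter (fun i : Fin n => 0 < i.val) = univ.erase ⟨0, by omega⟩ := by
        ext i
        simp [Fin.ext_iff, Nat.pos_iff_ne_zero]
      rw [h, Finset.card_erase_of_mem (mem_univ _), Finset.card_univ, Fintype.card_fin,
        Nat.cast_sub (by omega), Nat.cast_one]
    have h1 : ∀ i : Fin n, (1 / a - 1 / μ i) * (1 / μ i - 1 / b)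
        = (1 / a + 1 / b) * (1 / μ i) - 1 / μ i ^ 2 - 1 / (a * b) := by
      intro i
      simp only [one_div, mul_inv, inv_pow]
      ring
    simp only [h1, Finset.sum_sub_distrib, ← Finset.mul_sum, Finset.sum_const, nsmul_eq_mul,
      hcard]
    ring
  have key := key _ _ rfl rfl
  have hlo : ∀ i : Fin n, 0 < i.val → μ ⟨1, by omega⟩ ≤ μ i := fun i hi =>
    hmono (Fin.mk_le_of_le_val (by omega))
  have hhi : ∀ i : Fin n, μ i ≤ μ ⟨n - 1, by omega⟩ := fun i =>
    hmono (Fin.le_def.2 (by have := i.2; simp only; omega))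
  generalize hb : μ ⟨n - 1, by omega⟩ = b at *
  have hk : ∃ k : Fin n, 0 < k.val ∧ μ k = μ ⟨1, by omega⟩ ∧
      ∀ i : Fin n, k < i → μ i ≠ μ ⟨1, by omega⟩ := by
    have hne : (univ.filter (fun i : Fin n => μ i = μ ⟨1, by omega⟩)).Nonempty :=
      ⟨⟨1, by omega⟩, by simp⟩
    have hm := Finset.max'_mem _ hne
    have h1 := Finset.le_max' (univ.filter (fun i : Fin n => μ i = μ ⟨1, by omega⟩))
      ⟨1, by omega⟩ (by simp)
    refine ⟨_, ?_, (Finset.mem_filter.1 hm).2, ?_⟩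
    · exact lt_of_lt_of_le Nat.zero_lt_one (Fin.le_def.1 h1)
    · intro i hi he
      exact absurd (Finset.le_max' _ i (Finset.mem_filter.2 ⟨mem_univ _, he⟩)) (not_le.2 hi)
  generalize ha : μ ⟨1, by omega⟩ = a at *
  have hnn : ∀ i ∈ univ.filter (fun i : Fin n => 0 < i.val),
      0 ≤ (1 / a - 1 / μ i) * (1 / μ i - 1 / b) := by
    intro i hi
    have hi := (Finset.mem_filter.1 hi).2
    have h1 := one_div_le_one_div_of_le hμ2 (hlo i hi)
    have h2 := one_div_le_one_div_of_le (hμ2.trans_le (hlo i hi)) (hhi i)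
    exact mul_nonneg (by linarith) (by linarith)
  have hn0 : (0 : ℝ) < n := by exact_mod_cast (by omega : 0 < n)
  refine ⟨?_, ?_⟩
  · have := mul_nonneg hn0.le (Finset.sum_nonneg hnn)
    linarith
  · rw [eq_comm, ← sub_eq_zero, key, mul_eq_zero, or_iff_right hn0.ne',
      Finset.sum_eq_zero_iff_of_nonneg hnn]
    constructor
    · intro h
      obtain ⟨k, hk0, hka, hkm⟩ := hk
      refine ⟨k.val + 1, by omega, by omega, ?_, ?_⟩
      · intro i hi1 hi2
        exact le_antisymm (hka ▸ hmono (Fin.le_def.2 (by omega))) (hlo i (by omega))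
      · intro i hi
        have hne := hkm i (Fin.lt_def.2 (by omega))
        rcases mul_eq_zero.1 (h i (Finset.mem_filter.2 ⟨mem_univ _, by omega⟩)) with h | h
        · exact absurd (one_div_inj_aux (sub_eq_zero.1 h)).symm hne
        · exact one_div_inj_aux (sub_eq_zero.1 h)
    · rintro ⟨r, hr2, hrn, h1, h2⟩ i hi
      have hi := (Finset.mem_filter.1 hi).2
      rcases le_or_gt (i.val + 1) r with h | h
      · rw [h1 i (by omega) h]; simp
      · rw [h2 i (by omega)]; simp
end

section
/- Let S(a,b) be the double star on n vertices with a + b = n − 2, a ≥ 1, b ≥ 1. Then the characteristic polynomial of its Laplacian matrix is x(x−1)^{n−4}·[x³ − (n+2)x² + (2n + ab + 1)x − n], and consequently BH(S(a,b)) = n² − 2n + 4ab + (ab+1)²/n. -/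
open Finset Polynomial

/-- The double star `S(a,b)`: vertex `0` and vertex `1` are adjacent, vertex `0` has
the `a` pendant neighbours `2, …, a+1`, and vertex `1` has the `b` pendant
neighbours `a+2, …, a+b+1`. -/
def doubleStar (a b : ℕ) : SimpleGraph (Fin (a + b + 2)) :=
  SimpleGraph.fromRel (fun u v =>
    (u.val = 0 ∧ v.val = 1) ∨ (u.val = 0 ∧ 2 ≤ v.val ∧ v.val < a + 2) ∨
      (u.val = 1 ∧ a + 2 ≤ v.val))

noncomputable instance (a b : ℕ) : DecidableRel (doubleStar a b).Adj :=
  Classical.decRel _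


def dsEquiv (a b : ℕ) : Fin 2 ⊕ (Fin a ⊕ Fin b) ≃ Fin (a + b + 2) :=
  ((Equiv.sumCongr (Equiv.refl _) finSumFinEquiv).trans finSumFinEquiv).trans
    (finCongr (by omega))

lemma dsE0 (a b : ℕ) (i : Fin 2) : (dsEquiv a b (Sum.inl i)).val = i.val := by
  simp [dsEquiv]
lemma dsE1 (a b : ℕ) (i : Fin a) : (dsEquiv a b (Sum.inr (Sum.inl i))).val = i.val + 2 := by
  simp [dsEquiv]
lemma dsE2 (a b : ℕ) (i : Fin b) :
    (dsEquiv a b (Sum.inr (Sum.inr i))).val = i.val + a + 2 := by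
  simp [dsEquiv]; omega

lemma dsAdj (a b : ℕ) (u v : Fin (a + b + 2)) : (doubleStar a b).Adj u v ↔
    ((u.val = 0 ∧ v.val = 1) ∨ (u.val = 0 ∧ 2 ≤ v.val ∧ v.val < a + 2) ∨
      (u.val = 1 ∧ a + 2 ≤ v.val)) ∨ ((v.val = 0 ∧ u.val = 1) ∨
      (v.val = 0 ∧ 2 ≤ u.val ∧ u.val < a + 2) ∨
      (v.val = 1 ∧ a + 2 ≤ u.val)) := by
  rw [doubleStar, SimpleGraph.fromRel_adj, ne_eq, Fin.ext_iff]
  constructor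
  · exact fun h => h.2
  · intro h; exact ⟨by omega, h⟩

def dsA (a b : ℕ) : Matrix (Fin 2 ⊕ (Fin a ⊕ Fin b)) (Fin 2 ⊕ (Fin a ⊕ Fin b)) ℝ :=
  Matrix.fromBlocks !![0, 1; 1, 0]
    (Matrix.of ![Sum.elim 1 0, Sum.elim 0 1]) (Matrix.of ![Sum.elim 1 0, Sum.elim 0 1]).transpose 0

lemma ds_adjMatrix (a b : ℕ) :
    ((doubleStar a b).adjMatrix ℝ).submatrix (dsEquiv a b) (dsEquiv a b) = dsA a b := by
  ext i j
  rw [Matrix.submatrix_apply, SimpleGraph.adjMatrix_apply]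
  simp only [dsAdj]
  rcases i with i | i | i <;> rcases j with j | j | j <;>
    simp only [dsE0, dsE1, dsE2, dsA, Matrix.fromBlocks_apply₁₁, Matrix.fromBlocks_apply₁₂,
      Matrix.fromBlocks_apply₂₁, Matrix.fromBlocks_apply₂₂, Matrix.transpose_apply] <;>
    (try fin_cases i) <;> (try fin_cases j) <;> simp

lemma ds_deg (a b : ℕ) (i) : ((doubleStar a b).degree (dsEquiv a b i) : ℝ) =
    Sum.elim ![(a:ℝ) + 1, b + 1] 1 i := by
  have h : ((doubleStar a b).degree (dsEquiv a b i) : ℝ) = ∑ j, dsA a b i j := by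
    rw [← ds_adjMatrix]
    simp only [Matrix.submatrix_apply]
    rw [(dsEquiv a b).sum_comp (fun j => (doubleStar a b).adjMatrix ℝ (dsEquiv a b i) j)]
    simp only [SimpleGraph.adjMatrix_apply, Finset.sum_boole]
    rw [← SimpleGraph.card_neighborFinset_eq_degree, SimpleGraph.neighborFinset_eq_filter]
  rw [h, Fintype.sum_sum_type, Fintype.sum_sum_type]
  rcases i with i | i | i
  · fin_cases i <;> simp [dsA] <;> ring
  · simp [dsA]
  · simp [dsA]

lemma ds_sub (a b : ℕ) (x : ℝ) :
    (Matrix.scalar _ x - (doubleStar a b).lapMatrix ℝ).submatrix (dsEquiv a b) (dsEquiv a b) =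
    Matrix.fromBlocks !![x - (a + 1), 1; 1, x - (b + 1)]
    (Matrix.of ![Sum.elim 1 0, Sum.elim 0 1]) (Matrix.of ![Sum.elim 1 0, Sum.elim 0 1]).transpose
      (Matrix.diagonal (fun _ => x - 1)) := by
  have h : (Matrix.scalar _ x - (doubleStar a b).lapMatrix ℝ).submatrix
      (dsEquiv a b) (dsEquiv a b) =
      Matrix.diagonal (fun i => x - Sum.elim ![(a:ℝ) + 1, b + 1] 1 i) + dsA a b := by
    rw [← ds_adjMatrix]
    ext i j
    simp only [SimpleGraph.lapMatrix, SimpleGraph.degMatrix, Matrix.submatrix_apply,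
      Matrix.sub_apply, Matrix.add_apply, Matrix.scalar_apply, Matrix.diagonal_apply,
      EmbeddingLike.apply_eq_iff_eq, ds_deg]
    split_ifs <;> ring
  rw [h]
  ext i j
  rcases i with i | i <;> rcases j with j | j
  · fin_cases i <;> fin_cases j <;> simp [dsA]
  · simp [dsA]
  · simp [dsA]
  · rcases i with i | i <;> simp [dsA, Matrix.diagonal_apply]

lemma ds_eval (a b : ℕ) (x : ℝ) (hx : x - 1 ≠ 0) :
    (Matrix.scalar _ x - (doubleStar a b).lapMatrix ℝ).det =
    (x - 1) ^ (a + b) *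
      ((x - (a + 1) - a / (x - 1)) * (x - (b + 1) - b / (x - 1)) - 1) := by
  rw [← Matrix.det_submatrix_equiv_self (dsEquiv a b), ds_sub]
  let inv : Invertible (Matrix.diagonal (fun _ : Fin a ⊕ Fin b => x - 1)) :=
    ⟨Matrix.diagonal (fun _ => (x - 1)⁻¹), by simp [hx], by simp [hx]⟩
  rw [Matrix.det_fromBlocks₂₂]
  have : ⅟ (Matrix.diagonal (fun _ : Fin a ⊕ Fin b => x - 1)) =
    Matrix.diagonal (fun _ => (x - 1)⁻¹) := rfl
  rw [this, Matrix.det_diagonal, Matrix.det_fin_two]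
  simp [Matrix.mul_apply, Matrix.vecMul, Matrix.diagonal_apply, Fintype.sum_sum_type,
    Matrix.vecHead, Matrix.vecTail]
  left
  ring

lemma ds_charpoly {a b n : ℕ} (ha : 1 ≤ a) (hb : 1 ≤ b) (hn : n = a + b + 2) :
    ((doubleStar a b).lapMatrix ℝ).charpoly =
      X * (X - 1) ^ (n - 4) *
        (X ^ 3 - C ((n : ℝ) + 2) * X ^ 2 + C (2 * (n : ℝ) + (a : ℝ) * b + 1) * X - C (n : ℝ)) := by
  apply Polynomial.eq_of_infinite_eval_eq
  apply (Set.finite_singleton (1:ℝ)).infinite_compl.mono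
  intro x hx
  have hx' : x - 1 ≠ 0 := sub_ne_zero.mpr (by simpa using hx)
  rw [Set.mem_ofPred_eq, Matrix.eval_charpoly, ds_eval a b x hx']
  obtain ⟨k, hk⟩ : ∃ k, a + b = k + 2 := ⟨a + b - 2, by omega⟩
  have h4 : n - 4 = k := by omega
  rw [h4, hk]
  simp only [eval_mul, eval_X, eval_pow, eval_sub, eval_one, eval_add, eval_C]
  rw [hn]
  push_cast
  rw [pow_add, mul_assoc, mul_assoc, mul_left_comm]
  field_simp
  ring

theorem statement_8 {a b n : ℕ} (ha : 1 ≤ a) (hb : 1 ≤ b) (hn : n = a + b + 2)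
    (μ : Fin (a + b + 2) → ℝ) (hμ : IsLapEigSeq (doubleStar a b) μ) :
    ((doubleStar a b).lapMatrix ℝ).charpoly =
      X * (X - 1) ^ (n - 4) *
        (X ^ 3 - C ((n : ℝ) + 2) * X ^ 2 + C (2 * (n : ℝ) + (a : ℝ) * b + 1) * X - C (n : ℝ)) ∧
    (n : ℝ) * ∑ i ∈ univ.filter (fun i : Fin (a + b + 2) => 0 < i.val), 1 / μ i ^ 2 =
      (n : ℝ) ^ 2 - 2 * (n : ℝ) + 4 * ((a : ℝ) * b) + ((a : ℝ) * b + 1) ^ 2 / (n : ℝ) := by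
  have hc := ds_charpoly ha hb hn
  refine ⟨hc, ?_⟩
  obtain ⟨hmono, e, he⟩ := hμ
  have hP := SimpleGraph.posSemidef_lapMatrix (R := ℝ) (G := doubleStar a b)
  have hr : ((doubleStar a b).lapMatrix ℝ).charpoly.roots = Multiset.map μ univ.val := by
    rw [hP.1.roots_charpoly_eq_eigenvalues]
    have h1 : Multiset.map μ univ.val = Multiset.map (μ ∘ e) univ.val := by
      rw [← Multiset.map_map]
      congr 1
      have := congrArg Finset.val (Finset.map_univ_equiv e)
      rw [Finset.map_val] at this
      exact this.symm
    rw [h1]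
    apply Multiset.map_congr rfl
    intro v _
    exact he v
  set q : ℝ[X] := X ^ 3 - C ((n : ℝ) + 2) * X ^ 2 + C (2 * (n : ℝ) + (a : ℝ) * b + 1) * X
    - C (n : ℝ) with hq
  have hdeg : q.natDegree = 3 := by rw [hq]; compute_degree!
  have hmon : q.Monic := by rw [hq]; monicity!
  have hq0 : q ≠ 0 := hmon.ne_zero
  have hX1 : (X - 1 : ℝ[X]) ≠ 0 := by simpa using X_sub_C_ne_zero (1:ℝ)
  have hroots : (X * (X - 1) ^ (n - 4) * q).roots = {0} + (n - 4) • {1} + q.roots := by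
    rw [roots_mul (mul_ne_zero (mul_ne_zero X_ne_zero (pow_ne_zero _ hX1)) hq0),
      roots_mul (mul_ne_zero X_ne_zero (pow_ne_zero _ hX1)), roots_X, roots_pow]
    congr 3
    simpa using roots_X_sub_C (1:ℝ)
  rw [hc, hroots] at hr
  have hcard : Multiset.card q.roots = 3 := by
    have := congrArg Multiset.card hr
    simp at this
    omega
  have hprod := prod_multiset_X_sub_C_of_monic_of_roots_card_eq hmon (hcard.trans hdeg.symm)
  obtain ⟨r, s, t, hrst⟩ := Multiset.card_eq_three.mp hcard
  rw [hrst] at hprod hr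
  have ev : ∀ x : ℝ, (x - r) * ((x - s) * (x - t)) =
      x ^ 3 - (n + 2) * x ^ 2 + (2 * n + a * b + 1) * x - n := by
    intro x
    have := congrArg (Polynomial.eval x) hprod
    simpa [hq] using this
  have e0 := ev 0
  have e1 := ev 1
  have e2 := ev (-1)
  have v3 : r * s * t = n := by linarith
  have v1 : r + s + t = n + 2 := by linarith
  have v2 : r * s + r * t + s * t = 2 * n + a * b + 1 := by linarith
  have hn0 : (n : ℝ) ≠ 0 := by rw [hn]; positivity
  have hμ0 : μ 0 = 0 := by
    apply le_antisymm
    · have : (0:ℝ) ∈ Multiset.map μ univ.val := by rw [← hr]; simp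
      obtain ⟨i, -, hi⟩ := Multiset.mem_map.mp this
      rw [← hi]; exact hmono (Fin.zero_le i)
    · have := he (e.symm 0)
      rw [e.apply_symm_apply] at this
      rw [← this]
      exact hP.eigenvalues_nonneg _
  have hsum : ∑ i ∈ univ.filter (fun i : Fin (a + b + 2) => 0 < i.val), 1 / μ i ^ 2 =
      ∑ i, 1 / μ i ^ 2 := by
    apply Finset.sum_subset (Finset.filter_subset _ _)
    intro i _ hi
    have : i = 0 := by
      apply Fin.ext
      simpa using hi
    rw [this, hμ0]; simp
  have hs2 : ∑ i, 1 / μ i ^ 2 = ((n - 4 : ℕ) : ℝ) + (1 / r ^ 2 + (1 / s ^ 2 + 1 / t ^ 2)) := by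
    have : ∑ i, 1 / μ i ^ 2 = (Multiset.map (fun x : ℝ => 1 / x ^ 2) (Multiset.map μ univ.val)).sum := by
      rw [Multiset.map_map]; rfl
    rw [this, ← hr]
    simp [Multiset.map_nsmul, Multiset.sum_nsmul]
    ring
  have hr0 : r ≠ 0 := by rintro rfl; apply hn0; rw [← v3]; ring
  have hs0 : s ≠ 0 := by rintro rfl; apply hn0; rw [← v3]; ring
  have ht0 : t ≠ 0 := by rintro rfl; apply hn0; rw [← v3]; ring
  have hinv : 1 / r ^ 2 + (1 / s ^ 2 + 1 / t ^ 2) =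
      ((2 * n + a * b + 1) ^ 2 - 2 * (n + 2) * n) / (n : ℝ) ^ 2 := by
    rw [← v2, ← v1, ← v3]
    field_simp
    ring
  rw [hsum, hs2, hinv, Nat.cast_sub (by omega)]
  field_simp
  push_cast
  ring
end

section
/- Let T be a tree on n ≥ 8 vertices with diameter d(T). If d(T) ≥ π·(7n/8)^{1/4} − 1, then BH(T) > BH(K_{1,n−1}), where BH(K_{1,n−1}) = n(n − 2 + 1/n²). -/
open Finset Polynomial

open SimpleGraph in
theorem cross_edge {V : Type*} {T : SimpleGraph V} (hT : T.IsTree) {a b x y : V}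
    (p : T.Walk a b) (hp : p.IsPath) (hxy : T.Adj x y)
    (h1 : T.dist a y = T.dist a x + 1) (h2 : T.dist b x = T.dist b y + 1) :
    p.length = T.dist a x + 1 + T.dist b y ∧
    p.getVert (T.dist a x) = x ∧ p.getVert (T.dist a x + 1) = y := by
  classical
  obtain ⟨q, hq, hql⟩ := hT.connected.exists_path_of_dist a x
  obtain ⟨r, hr, hrl⟩ := hT.connected.exists_path_of_dist y b
  have hw : (q.append (Walk.cons hxy r)).IsPath := by
    rw [Walk.isPath_def, Walk.support_append, Walk.support_cons, List.tail_cons,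
      List.nodup_append']
    refine ⟨hq.support_nodup, hr.support_nodup, ?_⟩
    intro z hz1 hz2
    have e1 : (q.takeUntil z hz1).length + (q.dropUntil z hz1).length = q.length := by
      rw [← Walk.length_append, Walk.take_spec]
    have e2 : (r.takeUntil z hz2).length + (r.dropUntil z hz2).length = r.length := by
      rw [← Walk.length_append, Walk.take_spec]
    have t1 := T.dist_le (q.takeUntil z hz1)
    have t2 := T.dist_le (q.dropUntil z hz1)
    have t3 := T.dist_le (r.takeUntil z hz2)
    have t4 := T.dist_le (r.dropUntil z hz2)
    have s1 := hT.connected.dist_triangle (u := a) (v := z) (w := y)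
    have s2 := hT.connected.dist_triangle (u := b) (v := z) (w := x)
    rw [T.dist_comm (u := z) (v := y)] at s1
    rw [T.dist_comm (u := b) (v := z)] at s2
    rw [T.dist_comm (u := y) (v := b)] at hrl
    omega
  have hpw : p = q.append (Walk.cons hxy r) :=
    (hT.existsUnique_path a b).unique hp hw
  rw [T.dist_comm (u := y) (v := b)] at hrl
  subst hpw
  refine ⟨?_, ?_, ?_⟩
  · simp [hql, hrl]; omega
  · rw [Walk.getVert_append]; simp [hql]
  · rw [Walk.getVert_append]; simp [hql]

open SimpleGraph in
theorem getVert_dist {V : Type*} {T : SimpleGraph V} (hT : T.Connected) {a b : V}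
    (p : T.Walk a b) (hp : p.length = T.dist a b) {i : ℕ} (hi : i ≤ p.length) :
    T.dist a (p.getVert i) = i ∧ T.dist b (p.getVert i) = p.length - i := by
  have t1 := T.dist_le (p.take i)
  have t2 := T.dist_le (p.drop i)
  have s := hT.dist_triangle (u := a) (v := p.getVert i) (w := b)
  simp only [Walk.take_length, Walk.drop_length] at t1 t2
  rw [T.dist_comm (u := b)]
  omega

open SimpleGraph in
theorem tree_test {n : ℕ} (T : SimpleGraph (Fin n)) [DecidableRel T.Adj]
    (hT : T.IsTree) {a b : Fin n} (p : T.Walk a b) (hp : p.length = T.dist a b) (g : ℕ → ℝ) :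
    ∃ f : Fin n → ℝ, (∀ i ≤ p.length, f (p.getVert i) = g i) ∧
      (∑ i, ∑ j, if T.Adj i j then (f i - f j) ^ 2 else 0) ≤
        2 * ∑ k ∈ Finset.range p.length, (g (k + 1) - g k) ^ 2 := by
  have hpp := p.isPath_of_length_eq_dist hp
  refine ⟨fun x => g ((T.dist a x + p.length - T.dist b x) / 2), ?_, ?_⟩
  · intro i hi
    obtain ⟨e1, e2⟩ := getVert_dist hT.connected p hp hi
    simp only [e1, e2]
    congr 1; omega
  set f : Fin n → ℝ := fun x => g ((T.dist a x + p.length - T.dist b x) / 2) with hf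
  have key : ∀ x y : Fin n, (if T.Adj x y then (f x - f y) ^ 2 else 0) ≤
      ∑ k ∈ Finset.range p.length,
        ((if x = p.getVert k then if y = p.getVert (k + 1) then (g (k + 1) - g k) ^ 2 else 0 else 0)
        + (if y = p.getVert k then if x = p.getVert (k + 1) then (g (k + 1) - g k) ^ 2 else 0 else 0)) := by
    intro x y
    have nn : ∀ k ∈ Finset.range p.length, 0 ≤
        ((if x = p.getVert k then if y = p.getVert (k + 1) then (g (k + 1) - g k) ^ 2 else 0 else 0)
        + (if y = p.getVert k then if x = p.getVert (k + 1) then (g (k + 1) - g k) ^ 2 else 0 else 0)) := by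
      intro k _
      apply add_nonneg <;> split_ifs <;> positivity
    split_ifs with h
    swap
    · exact Finset.sum_nonneg nn
    rcases hT.dist_eq_dist_add_one_of_adj a h with h1 | h1 <;>
    rcases hT.dist_eq_dist_add_one_of_adj b h with h2 | h2
    · have : f x = f y := by
        simp only [hf, h1, h2]; congr 2; omega
      rw [this]; simpa using Finset.sum_nonneg nn
    · obtain ⟨c1, c2, c3⟩ := cross_edge hT p hpp h.symm h1 h2
      have hk : T.dist a y ∈ Finset.range p.length := by simp; omega
      refine le_trans ?_ (Finset.single_le_sum nn hk)
      have e1 : f x = g (T.dist a y + 1) := by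
        simp only [hf]; congr 1; omega
      have e2 : f y = g (T.dist a y) := by
        simp only [hf]; congr 1; omega
      rw [c2, c3, e1, e2]
      simp only [if_true]
      have : 0 ≤ (if x = y then if y = x then (g (T.dist a y + 1) - g (T.dist a y)) ^ 2 else 0 else 0) := by
        split_ifs <;> positivity
      linarith
    · obtain ⟨c1, c2, c3⟩ := cross_edge hT p hpp h h1 h2
      have hk : T.dist a x ∈ Finset.range p.length := by simp; omega
      refine le_trans ?_ (Finset.single_le_sum nn hk)
      have e1 : f y = g (T.dist a x + 1) := by
        simp only [hf]; congr 1; omega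
      have e2 : f x = g (T.dist a x) := by
        simp only [hf]; congr 1; omega
      rw [c2, c3, e1, e2]
      simp only [if_true]
      have : 0 ≤ (if y = x then if x = y then (g (T.dist a x + 1) - g (T.dist a x)) ^ 2 else 0 else 0) := by
        split_ifs <;> positivity
      nlinarith
    · have : f x = f y := by
        simp only [hf, h1, h2]; congr 2; omega
      rw [this]; simpa using Finset.sum_nonneg nn
  calc _ ≤ ∑ x : Fin n, ∑ y : Fin n, ∑ k ∈ Finset.range p.length,
        ((if x = p.getVert k then if y = p.getVert (k + 1) then (g (k + 1) - g k) ^ 2 else 0 else 0)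
        + (if y = p.getVert k then if x = p.getVert (k + 1) then (g (k + 1) - g k) ^ 2 else 0 else 0)) :=
        Finset.sum_le_sum fun x _ => Finset.sum_le_sum fun y _ => key x y
    _ = ∑ k ∈ Finset.range p.length, ∑ x : Fin n, ∑ y : Fin n,
        ((if x = p.getVert k then if y = p.getVert (k + 1) then (g (k + 1) - g k) ^ 2 else 0 else 0)
        + (if y = p.getVert k then if x = p.getVert (k + 1) then (g (k + 1) - g k) ^ 2 else 0 else 0)) := by
        rw [Finset.sum_comm (s := Finset.range p.length)]
        refine Finset.sum_congr rfl fun x _ => ?_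
        rw [Finset.sum_comm]
    _ ≤ _ := by
        rw [Finset.mul_sum]
        refine le_of_eq (Finset.sum_congr rfl fun k _ => ?_)
        simp only [Finset.sum_add_distrib]
        rw [two_mul]
        congr 1
        · simp
        · simp

theorem cos_diff (k : ℕ) (θ : ℝ) :
    ∑ i ∈ Finset.range k, (Real.cos ((2 * ((i + 1 : ℕ) : ℝ) + 1) * θ) - Real.cos ((2 * (i : ℝ) + 1) * θ)) ^ 2
     = (2 - 2 * Real.cos (2 * θ)) * ∑ i ∈ Finset.range k, Real.cos ((2 * (i : ℝ) + 1) * θ) ^ 2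
      + Real.cos ((2 * (k : ℝ) + 1) * θ) * (Real.cos ((2 * (k : ℝ) + 1) * θ) - Real.cos ((2 * (k : ℝ) - 1) * θ)) := by
  induction k with
  | zero => 
    simp only [Finset.range_zero, Finset.sum_empty, Nat.cast_zero]
    have : Real.cos ((2 * 0 - 1) * θ) = Real.cos ((2 * 0 + 1) * θ) := by
      rw [← Real.cos_neg]; congr 1; ring
    rw [this]; ring
  | succ k ih =>
    rw [Finset.sum_range_succ, ih, Finset.sum_range_succ]
    push_cast
    have a1 : (2 * ((k : ℝ) + 1) + 1) * θ = (2 * (k : ℝ) + 1) * θ + 2 * θ := by ring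
    have a2 : (2 * ((k : ℝ) + 1) - 1) * θ = (2 * (k : ℝ) + 1) * θ := by ring
    have a3 : (2 * (k : ℝ) - 1) * θ = (2 * (k : ℝ) + 1) * θ - 2 * θ := by ring
    rw [a1, a2, a3, Real.cos_add, Real.cos_sub]
    ring

theorem cos_sum (k : ℕ) (θ : ℝ) :
    2 * Real.sin θ * ∑ i ∈ Finset.range k, Real.cos ((2 * (i : ℝ) + 1) * θ) = Real.sin (2 * k * θ) := by
  induction k with
  | zero => simp
  | succ k ih =>
    rw [Finset.sum_range_succ, mul_add, ih]
    push_cast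
    have a1 : 2 * ((k : ℝ) + 1) * θ = (2 * k + 1) * θ + θ := by ring
    have a2 : 2 * (k : ℝ) * θ = (2 * k + 1) * θ - θ := by ring
    rw [a1, a2, Real.sin_add, Real.sin_sub]; ring

/-- path facts -/
theorem path_facts (d : ℕ) (hd : 1 ≤ d) : ∃ g : ℕ → ℝ,
    ∑ i ∈ Finset.range (d + 1), g i = 0 ∧ 0 < ∑ i ∈ Finset.range (d + 1), g i ^ 2 ∧
    ∑ k ∈ Finset.range d, (g (k + 1) - g k) ^ 2 ≤
      (Real.pi / (d + 1)) ^ 2 * ∑ i ∈ Finset.range (d + 1), g i ^ 2 := by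
  have hD : (2 : ℝ) ≤ d + 1 := by
    have : (1 : ℝ) ≤ d := by exact_mod_cast hd
    linarith
  set θ : ℝ := Real.pi / (2 * (d + 1)) with hθ
  have hpi := Real.pi_pos
  have hθpos : 0 < θ := by positivity
  have hmul : 2 * ((d : ℝ) + 1) * θ = Real.pi := by rw [hθ]; field_simp
  have hθlt : θ < Real.pi / 2 := by nlinarith
  refine ⟨fun i => Real.cos ((2 * (i : ℝ) + 1) * θ), ?_, ?_, ?_⟩
  · have := cos_sum (d + 1) θ
    push_cast at this
    rw [hmul, Real.sin_pi] at this
    have hs : 0 < Real.sin θ := Real.sin_pos_of_pos_of_lt_pi hθpos (by linarith)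
    rcases mul_eq_zero.1 this with h | h
    · linarith
    · exact h
  · have h0 : 0 < Real.cos ((2 * ((0 : ℕ) : ℝ) + 1) * θ) ^ 2 := by
      have : 0 < Real.cos θ := Real.cos_pos_of_mem_Ioo ⟨by linarith, hθlt⟩
      simp; positivity
    exact lt_of_lt_of_le h0 (Finset.single_le_sum
      (f := fun i : ℕ => Real.cos ((2 * (i : ℝ) + 1) * θ) ^ 2)
      (fun i _ => by positivity) (by simp : 0 ∈ Finset.range (d + 1)))
  · have h := cos_diff (d + 1) θ
    rw [Finset.sum_range_succ] at h
    have a1 : (2 * ((d + 1 : ℕ) : ℝ) + 1) * θ = Real.pi + θ := by push_cast; linarith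
    have a2 : (2 * ((d + 1 : ℕ) : ℝ) - 1) * θ = Real.pi - θ := by push_cast; linarith
    have a3 : (2 * (d : ℝ) + 1) * θ = Real.pi - θ := by linarith
    rw [a1, a2, a3] at h
    have c : Real.cos (Real.pi + θ) = Real.cos (Real.pi - θ) := by
      rw [Real.cos_pi_sub, add_comm, Real.cos_add_pi]
    rw [c] at h
    have hS : 0 ≤ ∑ i ∈ Finset.range (d + 1), Real.cos ((2 * (i : ℝ) + 1) * θ) ^ 2 :=
      Finset.sum_nonneg fun i _ => by positivity
    have hc := Real.one_sub_sq_div_two_le_cos (x := 2 * θ)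
    have e : Real.pi / (d + 1) = 2 * θ := by rw [hθ]; field_simp
    rw [e]
    have : (2 - 2 * Real.cos (2 * θ)) ≤ (2 * θ) ^ 2 := by linarith
    have := mul_le_mul_of_nonneg_right this hS
    simp only [sub_self, mul_zero, add_zero] at h
    norm_num at h this ⊢
    linarith

theorem zero_eigvec {n : ℕ} (T : SimpleGraph (Fin n)) [DecidableRel T.Adj]
    (hT : T.IsTree) (v : Fin n) (hv : lapEigsUnordered T v = 0) (x y : Fin n) :
    (SimpleGraph.posSemidef_lapMatrix (R := ℝ) (G := T)).1.eigenvectorBasis v x =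
    (SimpleGraph.posSemidef_lapMatrix (R := ℝ) (G := T)).1.eigenvectorBasis v y := by
  have h := (SimpleGraph.posSemidef_lapMatrix (R := ℝ) (G := T)).1.mulVec_eigenvectorBasis v
  unfold lapEigsUnordered at hv
  rw [hv, zero_smul, SimpleGraph.lapMatrix_mulVec_eq_zero_iff_forall_reachable] at h
  exact h x y (hT.connected x y)

theorem zero_unique {n : ℕ} (T : SimpleGraph (Fin n)) [DecidableRel T.Adj]
    (hT : T.IsTree) (v w : Fin n) (hv : lapEigsUnordered T v = 0)
    (hw : lapEigsUnordered T w = 0) : v = w := by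
  by_contra hne
  have cv := zero_eigvec T hT v hv
  have cw := zero_eigvec T hT w hw
  set b := (SimpleGraph.posSemidef_lapMatrix (R := ℝ) (G := T)).1.eigenvectorBasis with hb
  have h0 : inner ℝ (b v) (b w) = 0 := b.orthonormal.2 hne
  have nv : inner ℝ (b v) (b v) = (1 : ℝ) := by
    rw [real_inner_self_eq_norm_sq, b.orthonormal.1 v]; norm_num
  have nw : inner ℝ (b w) (b w) = (1 : ℝ) := by
    rw [real_inner_self_eq_norm_sq, b.orthonormal.1 w]; norm_num
  simp only [PiLp.inner_apply, RCLike.inner_apply, conj_trivial] at h0 nv nw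
  rw [Finset.sum_congr rfl (fun x _ => by rw [cv x v, cw x v])] at h0
  rw [Finset.sum_congr rfl (fun x _ => by rw [cv x v])] at nv
  rw [Finset.sum_congr rfl (fun x _ => by rw [cw x v])] at nw
  simp only [Finset.sum_const, nsmul_eq_mul] at h0 nv nw
  set N : ℝ := ((Finset.univ : Finset (Fin n)).card : ℝ)
  have : (N * (b w v * b v v)) * (N * (b w v * b v v)) = 1 := by
    calc _ = (N * (b v v * b v v)) * (N * (b w v * b w v)) := by ring
      _ = 1 := by rw [nv, nw]; norm_num
  rw [h0] at this
  norm_num at this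

theorem eig_facts {n : ℕ} (T : SimpleGraph (Fin n)) [DecidableRel T.Adj]
    (hT : T.IsTree) (hn : 0 < n) (μ : Fin n → ℝ) (hμ : IsLapEigSeq T μ) :
    μ ⟨0, hn⟩ = 0 ∧ (∀ i : Fin n, 0 < i.val → 0 < μ i) ∧ ∑ i, μ i = 2 * ((n : ℝ) - 1) := by
  obtain ⟨hm, e, he⟩ := hμ
  have hnn : ∀ i, 0 ≤ μ i := by
    intro i
    have := he (e.symm i)
    rw [Equiv.apply_symm_apply] at this
    rw [← this]
    exact (SimpleGraph.posSemidef_lapMatrix (R := ℝ) (G := T)).eigenvalues_nonneg _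
  have hz : μ ⟨0, hn⟩ = 0 := by
    have : Nonempty (Fin n) := ⟨⟨0, hn⟩⟩
    have hdet := SimpleGraph.det_lapMatrix_eq_zero T
    rw [(SimpleGraph.posSemidef_lapMatrix (R := ℝ) (G := T)).1.det_eq_prod_eigenvalues,
      Finset.prod_eq_zero_iff] at hdet
    obtain ⟨v, -, hv⟩ := hdet
    have h1 := he v
    have h2 : lapEigsUnordered T v = 0 := by exact_mod_cast hv
    have h3 : μ ⟨0, hn⟩ ≤ μ (e v) := hm (Fin.mk_le_of_le_val (Nat.zero_le _))
    have := hnn ⟨0, hn⟩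
    linarith
  refine ⟨hz, ?_, ?_⟩
  · intro i hi
    refine lt_of_le_of_ne (hnn i) fun h => ?_
    have := zero_unique T hT (e.symm i) (e.symm ⟨0, hn⟩) (by rw [he]; simp [← h])
      (by rw [he]; simp [hz])
    rw [e.symm.injective.eq_iff] at this
    rw [this] at hi
    simp at hi
  · rw [← Equiv.sum_comp e μ]
    simp_rw [← he]
    have ht := (SimpleGraph.posSemidef_lapMatrix (R := ℝ) (G := T)).1.trace_eq_sum_eigenvalues
    have h2 : (T.lapMatrix ℝ).trace = ∑ v, (T.degree v : ℝ) := by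
      simp [SimpleGraph.lapMatrix, SimpleGraph.degMatrix, Matrix.trace]
    have h3 := T.sum_degrees_eq_twice_card_edges
    have h4 := hT.card_edgeFinset
    rw [Fintype.card_fin] at h4
    have h5 : (∑ v, (T.degree v : ℝ)) = 2 * (T.edgeFinset.card : ℝ) := by exact_mod_cast h3
    have h6 : (T.edgeFinset.card : ℝ) + 1 = n := by exact_mod_cast h4
    unfold lapEigsUnordered
    have h7 : (T.lapMatrix ℝ).trace = ∑ v, (SimpleGraph.posSemidef_lapMatrix (R := ℝ) (G := T)).1.eigenvalues v := by
      simpa using ht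
    rw [← h7, h2, h5]
    linarith

theorem rayleigh {n : ℕ} (T : SimpleGraph (Fin n)) [DecidableRel T.Adj]
    (hT : T.IsTree) (hn : 1 < n) (μ : Fin n → ℝ) (hμ : IsLapEigSeq T μ)
    (f : Fin n → ℝ) (hf : ∑ x, f x = 0) :
    μ ⟨1, hn⟩ * ∑ x, f x ^ 2 ≤ (∑ i, ∑ j, if T.Adj i j then (f i - f j) ^ 2 else 0) / 2 := by
  rw [← SimpleGraph.lapMatrix_toLinearMap₂', Matrix.toLinearMap₂'_apply']
  obtain ⟨hz, hpos, -⟩ := eig_facts T hT (by omega) μ hμ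
  obtain ⟨hm, e, he⟩ := hμ
  have hH := (SimpleGraph.posSemidef_lapMatrix (R := ℝ) (G := T)).1
  set b := hH.eigenvectorBasis with hb
  have hmv := hH.mulVec_eigenvectorBasis
  have hconst := fun v hv => zero_eigvec T hT v hv
  set X : EuclideanSpace ℝ (Fin n) := WithLp.toLp 2 f with hX
  set Y : EuclideanSpace ℝ (Fin n) := WithLp.toLp 2 ((T.lapMatrix ℝ).mulVec f) with hY
  have s1 := b.sum_inner_mul_inner X X
  have s2 := b.sum_inner_mul_inner X Y
  have i1 : inner ℝ X X = ∑ x, f x ^ 2 := by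
    rw [PiLp.inner_apply]; simp [hX, sq]
  have i2 : inner ℝ X Y = f ⬝ᵥ ((T.lapMatrix ℝ).mulVec f) := by
    simp [PiLp.inner_apply, hX, hY, dotProduct, mul_comm]
  have i3 : ∀ v, inner ℝ (b v) Y = lapEigsUnordered T v * inner ℝ (b v) X := by
    intro v
    have a1 : inner ℝ (b v) Y = (⇑(b v)) ⬝ᵥ ((T.lapMatrix ℝ).mulVec f) := by
      simp [PiLp.inner_apply, hY, dotProduct, mul_comm]
    have a2 : inner ℝ (b v) X = (⇑(b v)) ⬝ᵥ f := by
      simp [PiLp.inner_apply, hX, dotProduct, mul_comm]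
    rw [a1, a2, Matrix.dotProduct_mulVec, ← Matrix.mulVec_transpose,
      (T.isSymm_lapMatrix ℝ).eq, hmv v, smul_dotProduct, smul_eq_mul]
    rfl
  rw [← i1, ← i2, ← s1, ← s2, Finset.mul_sum]
  refine Finset.sum_le_sum fun v _ => ?_
  rw [i3 v, real_inner_comm (b v) X]
  by_cases h0 : lapEigsUnordered T v = 0
  · have : inner ℝ (b v) X = (0 : ℝ) := by
      have hc := hconst v h0
      have a2 : inner ℝ (b v) X = ∑ x, b v x * f x := by
        simp [PiLp.inner_apply, hX, mul_comm]
      rw [a2, Finset.sum_congr rfl (fun x _ => by rw [show b v x = b v v from hc x v]),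
        ← Finset.mul_sum, hf, mul_zero]
    rw [this]; simp
  · have h1 : μ ⟨1, hn⟩ ≤ lapEigsUnordered T v := by
      rw [he]
      apply hm
      rw [Fin.le_def]
      by_contra hlt
      have : e v = ⟨0, by omega⟩ := by ext; simp at hlt ⊢; omega
      exact h0 (by rw [he, this, hz])
    nlinarith [mul_self_nonneg (inner ℝ (b v) X : ℝ)]

theorem mu_bound {n : ℕ} (T : SimpleGraph (Fin n)) [DecidableRel T.Adj]
    (hT : T.IsTree) (hn : 1 < n) (μ : Fin n → ℝ) (hμ : IsLapEigSeq T μ) (hd : 1 ≤ T.diam) :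
    μ ⟨1, hn⟩ ≤ (Real.pi / (T.diam + 1)) ^ 2 := by
  have : Nonempty (Fin n) := ⟨⟨0, by omega⟩⟩
  obtain ⟨-, hpos, -⟩ := eig_facts T hT (by omega) μ hμ
  obtain ⟨a, b, hab⟩ := T.exists_dist_eq_diam
  obtain ⟨p, hp, hpl⟩ := hT.connected.exists_path_of_dist a b
  obtain ⟨g, g1, g2, g3⟩ := path_facts T.diam hd
  obtain ⟨f, f1, f2⟩ := tree_test T hT p hpl g
  rw [hpl, hab] at f1 f2
  set m : ℝ := (∑ x, f x) / n with hm
  have hn0 : (n : ℝ) ≠ 0 := by positivity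
  have hr := rayleigh T hT hn μ hμ (fun x => f x - m) (by
    rw [Finset.sum_sub_distrib]; simp [hm]; field_simp; simp)
  simp only [sub_sub_sub_cancel_right] at hr
  have hlow : ∑ i ∈ Finset.range (T.diam + 1), g i ^ 2 ≤ ∑ x, (f x - m) ^ 2 := by
    calc _ ≤ ∑ i ∈ Finset.range (T.diam + 1), (g i - m) ^ 2 := by
          have : ∑ i ∈ Finset.range (T.diam + 1), (g i - m) ^ 2 =
            ∑ i ∈ Finset.range (T.diam + 1), g i ^ 2 - 2 * m * ∑ i ∈ Finset.range (T.diam + 1), g i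
             + ∑ i ∈ Finset.range (T.diam + 1), m ^ 2 := by
            rw [Finset.mul_sum, ← Finset.sum_sub_distrib, ← Finset.sum_add_distrib]
            exact Finset.sum_congr rfl fun i _ => by ring
          rw [this, g1]
          have : 0 ≤ ∑ i ∈ Finset.range (T.diam + 1), m ^ 2 := Finset.sum_nonneg fun _ _ => sq_nonneg _
          linarith
      _ = ∑ i ∈ Finset.range (T.diam + 1), (f (p.getVert i) - m) ^ 2 := by
          refine Finset.sum_congr rfl fun i hi => ?_
          rw [f1 i (by simp at hi; omega)]
      _ = ∑ x ∈ (Finset.range (T.diam + 1)).image p.getVert, (f x - m) ^ 2 := by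
          rw [Finset.sum_image]
          intro i hi j hj hij
          refine hp.getVert_injOn ?_ ?_ hij <;> simp at hi hj ⊢ <;> omega
      _ ≤ _ := Finset.sum_le_sum_of_subset_of_nonneg (Finset.subset_univ _) fun _ _ _ => sq_nonneg _
  have hp1 := hpos ⟨1, hn⟩ (by simp)
  have h1 : μ ⟨1, hn⟩ * ∑ i ∈ Finset.range (T.diam + 1), g i ^ 2 ≤
      (Real.pi / (T.diam + 1)) ^ 2 * ∑ i ∈ Finset.range (T.diam + 1), g i ^ 2 := by
    have := mul_le_mul_of_nonneg_left hlow hp1.le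
    linarith
  exact le_of_mul_le_mul_right h1 g2

theorem tangent {t : ℝ} (ht : 0 < t) : 3 / 4 - t / 4 ≤ 1 / t ^ 2 := by
  rw [le_div_iff₀ (by positivity)]
  nlinarith [mul_nonneg (sq_nonneg (t - 2)) (by linarith : 0 ≤ t + 1)]

theorem statement_10 {n : ℕ} (hn : 8 ≤ n) (T : SimpleGraph (Fin n)) [DecidableRel T.Adj]
    (hT : T.IsTree) (μ : Fin n → ℝ) (hμ : IsLapEigSeq T μ)
    (hd : Real.pi * ((7 * (n : ℝ)) / 8) ^ ((1 : ℝ) / 4) - 1 ≤ (T.diam : ℝ)) :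
    (n : ℝ) * ∑ i ∈ univ.filter (fun i : Fin n => 0 < i.val), 1 / μ i ^ 2 > (n : ℝ) * ((n : ℝ) - 2 + 1 / (n : ℝ) ^ 2) := by
  have hn8 : (8 : ℝ) ≤ n := by exact_mod_cast hn
  have hpi := Real.pi_gt_three
  set s : ℝ := ((7 * (n : ℝ)) / 8) ^ ((1 : ℝ) / 4) with hs
  have hs4 : s ^ 4 = 7 * n / 8 := by
    rw [hs, ← Real.rpow_natCast, ← Real.rpow_mul (by positivity)]; norm_num
  have hs1 : 1 ≤ s := Real.one_le_rpow (by linarith) (by norm_num)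
  have hd1 : 1 ≤ T.diam := by
    have : (1 : ℝ) ≤ T.diam := by nlinarith
    exact_mod_cast this
  have hb := mu_bound T hT (by omega) μ hμ hd1
  obtain ⟨hz, hpos, htr⟩ := eig_facts T hT (by omega) μ hμ
  have hp1 := hpos ⟨1, by omega⟩ (by simp)
  have hms : μ ⟨1, by omega⟩ * s ^ 2 ≤ 1 := by
    have h1 : Real.pi / (T.diam + 1) * s ≤ 1 := by
      rw [div_mul_eq_mul_div, div_le_one (by positivity)]; linarith
    have h2 : 0 ≤ Real.pi / (T.diam + 1) * s := by positivity
    calc _ ≤ (Real.pi / (T.diam + 1)) ^ 2 * s ^ 2 := by gcongr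
      _ = (Real.pi / (T.diam + 1) * s) ^ 2 := by ring
      _ ≤ 1 := pow_le_one₀ h2 h1
  have hinv : 7 * (n : ℝ) / 8 ≤ 1 / μ ⟨1, by omega⟩ ^ 2 := by
    rw [← hs4, le_div_iff₀ (by positivity)]
    calc _ = (μ ⟨1, by omega⟩ * s ^ 2) ^ 2 := by ring
      _ ≤ 1 := pow_le_one₀ (by positivity) hms
  apply mul_lt_mul_of_pos_left _ (by linarith)
  have hmem : (⟨1, by omega⟩ : Fin n) ∈ univ.filter (fun i : Fin n => 0 < i.val) := by simp
  have hF : univ.filter (fun i : Fin n => 0 < i.val) = univ.erase ⟨0, by omega⟩ := by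
    ext i; simp [Fin.ext_iff, Nat.pos_iff_ne_zero]
  have hcard : (univ.filter (fun i : Fin n => 0 < i.val)).card = n - 1 := by
    rw [hF, Finset.card_erase_of_mem (Finset.mem_univ _)]; simp
  have hsum : ∑ i ∈ univ.filter (fun i : Fin n => 0 < i.val), μ i = 2 * ((n : ℝ) - 1) := by
    rw [hF, ← htr, ← Finset.add_sum_erase _ _ (Finset.mem_univ (⟨0, by omega⟩ : Fin n)), hz, zero_add]
  have hrest : ∑ i ∈ (univ.filter (fun i : Fin n => 0 < i.val)).erase ⟨1, by omega⟩, (3 / 4 - μ i / 4)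
      ≤ ∑ i ∈ (univ.filter (fun i : Fin n => 0 < i.val)).erase ⟨1, by omega⟩, 1 / μ i ^ 2 := by
    refine Finset.sum_le_sum fun i hi => tangent (hpos i ?_)
    simpa using (Finset.mem_filter.1 (Finset.mem_of_mem_erase hi)).2
  rw [← Finset.add_sum_erase _ _ hmem] at hsum ⊢
  rw [Finset.sum_sub_distrib, Finset.sum_const, ← Finset.sum_div,
    Finset.card_erase_of_mem hmem, hcard, nsmul_eq_mul] at hrest
  have hc : ((n - 1 - 1 : ℕ) : ℝ) = n - 2 := by
    rw [Nat.sub_sub, Nat.cast_sub (by omega)]; norm_num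
  rw [hc] at hrest
  have hsmall : 1 / (n : ℝ) ^ 2 ≤ 1 := by
    rw [div_le_one (by positivity)]; nlinarith
  linarith
end

section
/- Let G be a connected simple graph with n vertices and diameter d(G) = 2. Then BH(G) ≤ BH(K_{1,n−1}) = n(n − 2 + 1/n²), with equality if and only if G is the star K_{1,n−1}. -/
open Finset Polynomial

/-- The star `K_{1,n-1}` on `n` vertices, with centre `0`. -/
def starGraph (n : ℕ) : SimpleGraph (Fin n) :=
  SimpleGraph.fromRel (fun u _ => u.val = 0)


lemma aux_dist2 {n : ℕ} (G : SimpleGraph (Fin n)) (hG : G.Connected) (hd : G.diam = 2)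
    (u v : Fin n) : ∃ p : G.Walk u v, p.IsPath ∧ p.length ≤ 2 := by
  obtain ⟨p, hp, hl⟩ := hG.exists_path_of_dist u v
  refine ⟨p, hp, ?_⟩
  rw [hl, ← hd]
  exact SimpleGraph.dist_le_diam (SimpleGraph.ediam_ne_top_of_diam_ne_zero (by omega))

lemma aux_cases {n : ℕ} (G : SimpleGraph (Fin n)) (hG : G.Connected) (hd : G.diam = 2)
    (u v : Fin n) : u = v ∨ G.Adj u v ∨ ∃ w, G.Adj u w ∧ G.Adj w v := by
  obtain ⟨p, -, hl⟩ := aux_dist2 G hG hd u v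
  match p with
  | .nil => exact Or.inl rfl
  | .cons h .nil => exact Or.inr (Or.inl h)
  | .cons h (.cons h' .nil) => exact Or.inr (Or.inr ⟨_, h, h'⟩)
  | .cons h (.cons h' (.cons h'' q)) => simp at hl

lemma aux_lap {n : ℕ} (G : SimpleGraph (Fin n)) [DecidableRel G.Adj] (f : Fin n → ℝ) (t : ℝ)
    (h : (G.lapMatrix ℝ).mulVec f = t • f) (v : Fin n) :
    ∑ w ∈ G.neighborFinset v, (f v - f w) = t * f v := by
  have := congrFun h v
  rw [SimpleGraph.lapMatrix_mulVec_apply] at this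
  simp only [Pi.smul_apply, smul_eq_mul] at this
  rw [← this, Finset.sum_sub_distrib]
  simp

lemma aux_sum {n : ℕ} (G : SimpleGraph (Fin n)) [DecidableRel G.Adj] (f : Fin n → ℝ) (t : ℝ)
    (h : (G.lapMatrix ℝ).mulVec f = t • f) (ht : t ≠ 0) : ∑ v, f v = 0 := by
  have h1 : (fun _ => (1:ℝ)) ⬝ᵥ ((G.lapMatrix ℝ).mulVec f) = 0 := by
    rw [Matrix.dotProduct_mulVec, ← Matrix.mulVec_transpose, (G.isSymm_lapMatrix ℝ).eq,
      SimpleGraph.lapMatrix_mulVec_const_eq_zero]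
    simp
  rw [h] at h1
  simp only [dotProduct, Pi.smul_apply, smul_eq_mul, one_mul, ← Finset.mul_sum] at h1
  exact (mul_eq_zero.1 h1).resolve_left ht

lemma aux_le {n : ℕ} (G : SimpleGraph (Fin n)) [DecidableRel G.Adj] (f : Fin n → ℝ) (t : ℝ)
    (h : (G.lapMatrix ℝ).mulVec f = t • f) (v : Fin n) (hv : ∀ w, f w ≤ f v)
    (w : Fin n) (hw : G.Adj v w) : f v - f w ≤ t * f v := by
  rw [← aux_lap G f t h v]
  exact Finset.single_le_sum (f := fun w => f v - f w) (fun i _ => by simpa using hv i) (by simpa using hw)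

lemma aux_bounds {n : ℕ} (G : SimpleGraph (Fin n)) [DecidableRel G.Adj]
    (hG : G.Connected) (hd : G.diam = 2) (f : Fin n → ℝ) (hf : f ≠ 0) (t : ℝ)
    (h : (G.lapMatrix ℝ).mulVec f = t • f) (ht : t ≠ 0) : 1 ≤ t ∧ t ≤ n := by
  have hne : Nonempty (Fin n) := hG.nonempty
  have hs := aux_sum G f t h ht
  obtain ⟨v, hv⟩ := Finite.exists_max f
  obtain ⟨u, hu⟩ := Finite.exists_min f
  have hpos : 0 < f v := by
    by_contra hc
    apply hf
    have := (Finset.sum_eq_zero_iff_of_nonpos (s := univ) (f := f)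
      (fun i _ => (hv i).trans (not_lt.1 hc))).1 hs
    ext i; simpa using this i
  have hneg : f u < 0 := by
    by_contra hc
    apply hf
    have := (Finset.sum_eq_zero_iff_of_nonneg (s := univ) (f := f)
      (fun i _ => (not_lt.1 hc).trans (hu i))).1 hs
    ext i; simpa using this i
  constructor
  · by_contra hc
    push Not at hc
    have h1 : ∀ w, G.Adj v w → 0 < f w := fun w hw => by
      have := aux_le G f t h v hv w hw
      nlinarith
    have h2 : ∀ w, G.Adj u w → f w < 0 := fun w hw => by
      have := aux_le G (-f) t (by rw [Matrix.mulVec_neg, h, smul_neg]) u (by simpa using hu) w hw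
      simp only [Pi.neg_apply] at this
      nlinarith
    rcases aux_cases G hG hd u v with e | e | ⟨w, e, e'⟩
    · subst e; linarith
    · linarith [h2 v e]
    · linarith [h2 w e, h1 w e'.symm]
  · have h1 : t * f v ≤ ∑ w, (f v - f w) := by
      rw [← aux_lap G f t h v]
      exact Finset.sum_le_sum_of_subset_of_nonneg (Finset.subset_univ _)
        (fun i _ _ => by simpa using hv i)
    rw [Finset.sum_sub_distrib, hs] at h1
    simp at h1
    exact le_of_mul_le_mul_right h1 hpos

lemma aux_vec {n : ℕ} (G : SimpleGraph (Fin n)) [DecidableRel G.Adj] (v : Fin n) :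
    (G.lapMatrix ℝ).mulVec ((SimpleGraph.posSemidef_lapMatrix (R := ℝ) (G := G)).1.eigenvectorBasis v)
      = lapEigsUnordered G v •
        ((SimpleGraph.posSemidef_lapMatrix (R := ℝ) (G := G)).1.eigenvectorBasis v : Fin n → ℝ) :=
  Matrix.IsHermitian.mulVec_eigenvectorBasis _ v

lemma aux_vec_ne {n : ℕ} (G : SimpleGraph (Fin n)) [DecidableRel G.Adj] (v : Fin n) :
    ((SimpleGraph.posSemidef_lapMatrix (R := ℝ) (G := G)).1.eigenvectorBasis v : Fin n → ℝ) ≠ 0 := by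
  intro h
  apply (SimpleGraph.posSemidef_lapMatrix (R := ℝ) (G := G)).1.eigenvectorBasis.orthonormal.ne_zero v
  ext i
  exact congrFun h i

lemma aux_eig {n : ℕ} (G : SimpleGraph (Fin n)) [DecidableRel G.Adj] (f : Fin n → ℝ) (hf : f ≠ 0)
    (t : ℝ) (h : (G.lapMatrix ℝ).mulVec f = t • f) : ∃ v, lapEigsUnordered G v = t := by
  have h1 : Module.End.HasEigenvalue (Matrix.toLin' (G.lapMatrix ℝ)) t :=
    Module.End.hasEigenvalue_of_hasEigenvector (x := f)
      ⟨Module.End.mem_eigenspace_iff.2 (by simpa using h), hf⟩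
  have h2 := h1.mem_spectrum
  rw [Matrix.spectrum_toLin',
    (SimpleGraph.posSemidef_lapMatrix (R := ℝ) (G := G)).1.spectrum_real_eq_range_eigenvalues] at h2
  exact h2

lemma aux_zero_uniq {n : ℕ} (G : SimpleGraph (Fin n)) [DecidableRel G.Adj]
    (hG : G.Connected) (u v : Fin n) (hu : lapEigsUnordered G u = 0)
    (hv : lapEigsUnordered G v = 0) : u = v := by
  by_contra huv
  have key : ∀ w, lapEigsUnordered G w = 0 → ∀ i j,
      (SimpleGraph.posSemidef_lapMatrix (R := ℝ) (G := G)).1.eigenvectorBasis w i =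
      (SimpleGraph.posSemidef_lapMatrix (R := ℝ) (G := G)).1.eigenvectorBasis w j := by
    intro w hw i j
    have := aux_vec G w
    rw [hw, zero_smul, SimpleGraph.lapMatrix_mulVec_eq_zero_iff_forall_reachable] at this
    exact this i j (hG i j)
  have ho := (SimpleGraph.posSemidef_lapMatrix (R := ℝ) (G := G)).1.eigenvectorBasis.orthonormal.inner_eq_zero huv
  have ku := key u hu
  have kv := key v hv
  have nu := aux_vec_ne G u
  have nv := aux_vec_ne G v
  generalize (SimpleGraph.posSemidef_lapMatrix (R := ℝ) (G := G)).1.eigenvectorBasis u = x at *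
  generalize (SimpleGraph.posSemidef_lapMatrix (R := ℝ) (G := G)).1.eigenvectorBasis v = y at *
  have hx : ∀ i, x i ≠ 0 := fun i hi => nu (by ext j; rw [ku j i, hi]; rfl)
  have hy : ∀ i, y i ≠ 0 := fun i hi => nv (by ext j; rw [kv j i, hi]; rfl)
  rw [PiLp.inner_apply] at ho
  have : ∀ i, inner ℝ (x i) (y i) = x u * y u := fun i => by
    rw [ku u i, kv u i]; simp [mul_comm]
  simp only [this, Finset.sum_const, Finset.card_univ, Fintype.card_fin, nsmul_eq_mul] at ho
  have hn : (n : ℝ) ≠ 0 := by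
    have := u.pos
    exact_mod_cast this.ne'
  exact mul_ne_zero hn (mul_ne_zero (hx u) (hy u)) ho

lemma aux_trace {n : ℕ} (G : SimpleGraph (Fin n)) [DecidableRel G.Adj] :
    ∑ v, lapEigsUnordered G v = 2 * (#G.edgeFinset : ℝ) := by
  have h := (SimpleGraph.posSemidef_lapMatrix (R := ℝ) (G := G)).1.trace_eq_sum_eigenvalues
  have h2 : (G.lapMatrix ℝ).trace = ∑ v, (G.degree v : ℝ) := by
    simp [Matrix.trace, SimpleGraph.lapMatrix, SimpleGraph.degMatrix]
  have h3 := G.sum_degrees_eq_twice_card_edges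
  have h4 : ∑ v, (G.degree v : ℝ) = 2 * (#G.edgeFinset : ℝ) := by exact_mod_cast h3
  rw [← h4, ← h2, h]
  rfl

/-- A tree of diameter two has a centre. -/
lemma aux_tree {n : ℕ} (G : SimpleGraph (Fin n)) (hG : G.IsTree) (hd : G.diam = 2) :
    ∃ c, ∀ a b, G.Adj a b ↔ a ≠ b ∧ (a = c ∨ b = c) := by
  have hc := hG.connected
  have : Nonempty (Fin n) := hc.nonempty
  have uniq : ∀ (a b : Fin n) (p q : G.Walk a b), p.IsPath → q.IsPath → p.length = q.length := by
    intro a b p q hp hq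
    rw [(hG.existsUnique_path a b).unique hp hq]
  obtain ⟨u, w, huw⟩ := G.exists_dist_eq_diam
  rw [hd] at huw
  have huw' : u ≠ w := by rintro rfl; simp at huw
  have hnadj : ¬ G.Adj u w := fun h => by
    rw [SimpleGraph.dist_eq_one_iff_adj.2 h] at huw; omega
  obtain ⟨c, huc, hcw⟩ : ∃ c, G.Adj u c ∧ G.Adj c w := by
    rcases aux_cases G hc hd u w with e | e | e
    · exact absurd e huw'
    · exact absurd e hnadj
    · exact e
  have hall : ∀ x, x ≠ c → G.Adj c x := by
    intro x hx
    by_contra hcx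
    obtain ⟨y, hcy, hyx⟩ : ∃ y, G.Adj c y ∧ G.Adj y x := by
      rcases aux_cases G hc hd c x with e | e | e
      · exact absurd e.symm hx
      · exact absurd e hcx
      · exact e
    obtain ⟨z, hz, hzy⟩ : ∃ z, G.Adj z c ∧ z ≠ y := by
      by_cases h : u = y
      · exact ⟨w, hcw.symm, fun h' => huw' (h.trans h'.symm)⟩
      · exact ⟨u, huc, h⟩
    have hzx : z ≠ x := by rintro rfl; exact hcx hz.symm
    obtain ⟨p, hp, hl⟩ := aux_dist2 G hc hd z x
    have hq : (SimpleGraph.Walk.cons hz (.cons hcy (.cons hyx .nil))).IsPath := by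
      simp [SimpleGraph.Walk.cons_isPath_iff, hz.ne, hcy.ne, hyx.ne, hzy, hzx, hx.symm]
    have := uniq _ _ _ _ hp hq
    simp at this
    omega
  refine ⟨c, fun a b => ⟨fun hab => ⟨hab.ne, ?_⟩, ?_⟩⟩
  · by_contra hcon
    push Not at hcon
    have h1 := hall a hcon.1
    have h2 := hall b hcon.2
    have hq : (SimpleGraph.Walk.cons h1 (.cons hab .nil)).IsPath := by
      simp [SimpleGraph.Walk.cons_isPath_iff, h1.ne, hab.ne, h2.ne]
    have hq' : (SimpleGraph.Walk.cons h2 .nil).IsPath := by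
      simp [SimpleGraph.Walk.cons_isPath_iff, h2.ne]
    have := uniq _ _ _ _ hq hq'
    simp at this
  · rintro ⟨hab, rfl | rfl⟩
    · exact hall _ hab.symm
    · exact (hall _ hab).symm

lemma aux_star_iso {n : ℕ} (G : SimpleGraph (Fin n)) (c : Fin n)
    (h : ∀ a b, G.Adj a b ↔ a ≠ b ∧ (a = c ∨ b = c)) : Nonempty (G ≃g starGraph n) := by
  have : NeZero n := ⟨c.pos.ne'⟩
  refine ⟨⟨Equiv.swap c 0, ?_⟩⟩
  intro a b
  have hk : ∀ a, (Equiv.swap c 0 a).val = 0 ↔ a = c := by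
    intro a
    rw [← Fin.val_zero n, ← Fin.ext_iff]
    constructor
    · intro h; apply (Equiv.swap c 0).injective; simpa using h
    · rintro rfl; simp
  rw [h]
  simp only [starGraph, SimpleGraph.fromRel_adj, hk, ne_eq, EmbeddingLike.apply_eq_iff_eq]

lemma aux_iso_star {n : ℕ} (hn : 2 ≤ n) (G : SimpleGraph (Fin n)) (e : G ≃g starGraph n) :
    ∃ c, ∀ a b, G.Adj a b ↔ a ≠ b ∧ (a = c ∨ b = c) := by
  have : NeZero n := ⟨by omega⟩
  refine ⟨e.symm 0, fun a b => ?_⟩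
  have hk : ∀ a, (e a).val = 0 ↔ a = e.symm 0 := by
    intro a
    rw [← Fin.val_zero n, ← Fin.ext_iff]
    constructor
    · intro h; rw [← h]; simp
    · rintro rfl; simp
  rw [← e.map_adj_iff, ← hk a, ← hk b]
  have : a = b ↔ e a = e b := e.injective.eq_iff.symm
  simp only [starGraph, SimpleGraph.fromRel_adj, ne_eq, this]

lemma aux_star_edges {n : ℕ} (G : SimpleGraph (Fin n)) [DecidableRel G.Adj] (c : Fin n)
    (h : ∀ a b, G.Adj a b ↔ a ≠ b ∧ (a = c ∨ b = c)) : #G.edgeFinset + 1 = n := by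
  have h3 := G.sum_degrees_eq_twice_card_edges
  have hc : G.degree c = n - 1 := by
    have : G.neighborFinset c = univ.erase c := by ext x; simp [h, eq_comm]
    rw [← SimpleGraph.card_neighborFinset_eq_degree, this]; simp
  have ho : ∀ x ∈ univ.erase c, G.degree x = 1 := by
    intro x hx
    have : G.neighborFinset x = {c} := by
      ext y; simp at hx; simp [h, hx]; rintro rfl; exact hx
    rw [← SimpleGraph.card_neighborFinset_eq_degree, this]; simp
  rw [← Finset.add_sum_erase _ _ (Finset.mem_univ c), hc, Finset.sum_congr rfl ho] at h3
  simp at h3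
  have := c.pos
  omega

lemma aux_star_eig {n : ℕ} (hn : 2 ≤ n) (G : SimpleGraph (Fin n)) [DecidableRel G.Adj] (c : Fin n)
    (h : ∀ a b, G.Adj a b ↔ a ≠ b ∧ (a = c ∨ b = c)) : ∃ v, lapEigsUnordered G v = n := by
  have hn' : (2:ℝ) ≤ n := by exact_mod_cast hn
  apply aux_eig G (fun x => if x = c then (n:ℝ) - 1 else -1)
  · intro h0
    have := congrFun h0 c
    simp at this
    linarith
  · ext v
    rw [SimpleGraph.lapMatrix_mulVec_apply]
    by_cases hv : v = c
    · subst hv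
      have : G.neighborFinset v = univ.erase v := by ext x; simp [h, eq_comm]
      rw [← SimpleGraph.card_neighborFinset_eq_degree, this,
        Finset.sum_congr rfl (g := fun _ => (-1:ℝ)) (by intro x hx; simp at hx; simp [hx])]
      have : 1 ≤ n := by omega
      simp [this]
      ring
    · have : G.neighborFinset v = {c} := by
        ext y; simp [h, hv]; rintro rfl; exact hv
      rw [← SimpleGraph.card_neighborFinset_eq_degree, this]
      simp [hv]
      ring

theorem statement_11 {n : ℕ} (hn : 2 ≤ n) (G : SimpleGraph (Fin n)) [DecidableRel G.Adj]
    (hG : G.Connected) (hd : G.diam = 2) (μ : Fin n → ℝ) (hμ : IsLapEigSeq G μ) :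
    (n : ℝ) * ∑ i ∈ univ.filter (fun i : Fin n => 0 < i.val), 1 / μ i ^ 2 ≤ (n : ℝ) * ((n : ℝ) - 2 + 1 / (n : ℝ) ^ 2) ∧
    ((n : ℝ) * ∑ i ∈ univ.filter (fun i : Fin n => 0 < i.val), 1 / μ i ^ 2 = (n : ℝ) * ((n : ℝ) - 2 + 1 / (n : ℝ) ^ 2) ↔
      Nonempty (G ≃g starGraph n)) := by
  have hNZ : NeZero n := ⟨by omega⟩
  have hn' : (2:ℝ) ≤ n := by exact_mod_cast hn
  obtain ⟨hmono, e, he⟩ := hμ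
  have hμe : ∀ i, μ i = lapEigsUnordered G (e.symm i) := fun i => by rw [he]; simp
  have hb : ∀ i, μ i ≠ 0 → 1 ≤ μ i ∧ μ i ≤ n := by
    intro i hi
    rw [hμe] at hi ⊢
    exact aux_bounds G hG hd _ (aux_vec_ne G _) _ (aux_vec G _) hi
  have hnn : ∀ i, 0 ≤ μ i := fun i => by
    by_cases h : μ i = 0
    · exact h.ge
    · linarith [hb i h]
  have h0 : μ 0 = 0 := by
    obtain ⟨v, hv⟩ := aux_eig G (fun _ => 1) (fun h => by simpa using congrFun h 0) 0
      (by rw [SimpleGraph.lapMatrix_mulVec_const_eq_zero, zero_smul])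
    rw [he] at hv
    exact le_antisymm (hv ▸ hmono (Fin.zero_le _)) (hnn 0)
  have hS : univ.filter (fun i : Fin n => 0 < i.val) = univ.erase 0 := by
    ext i
    simp only [Finset.mem_filter, Finset.mem_univ, true_and, Finset.mem_erase, and_true, ne_eq,
      Fin.ext_iff, Fin.val_zero, Nat.pos_iff_ne_zero]
  rw [hS]
  have hbd : ∀ i ∈ univ.erase (0 : Fin n), 1 ≤ μ i ∧ μ i ≤ n := by
    intro i hi
    apply hb
    intro hi0
    rw [Finset.mem_erase] at hi
    apply hi.1
    apply e.symm.injective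
    apply aux_zero_uniq G hG
    · rw [← hμe, hi0]
    · rw [← hμe, h0]
  have htr : ∑ i ∈ univ.erase (0 : Fin n), μ i = 2 * (#G.edgeFinset : ℝ) := by
    rw [← aux_trace G, ← zero_add (∑ i ∈ univ.erase (0 : Fin n), μ i), ← h0,
      Finset.add_sum_erase _ _ (Finset.mem_univ _)]
    simp only [he]
    exact (Equiv.sum_comp e μ).symm
  have hcard : (#(univ.erase (0 : Fin n)) : ℝ) = n - 1 := by
    rw [Finset.card_erase_of_mem (Finset.mem_univ _), Finset.card_univ, Fintype.card_fin,
      Nat.cast_sub (by omega)]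
    simp
  have hm : n ≤ #G.edgeFinset + 1 := by
    have := hG.card_vert_le_card_edgeSet_add_one
    rwa [Nat.card_eq_fintype_card, Nat.card_eq_fintype_card, Fintype.card_fin,
      ← SimpleGraph.edgeFinset_card] at this
  have hm' : (n : ℝ) ≤ #G.edgeFinset + 1 := by exact_mod_cast hm
  -- chord bound
  have hchord : ∀ i ∈ univ.erase (0 : Fin n),
      1 / μ i ^ 2 ≤ 1 - (1 - 1 / (n:ℝ)^2) / (n - 1) * (μ i - 1) := by
    intro i hi
    obtain ⟨h1, h2⟩ := hbd i hi
    have e1 : (1 - 1 / (n:ℝ)^2) / (n - 1) = (n + 1) / n ^ 2 := by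
      have : (n:ℝ) - 1 ≠ 0 := by linarith
      field_simp
      ring
    rw [e1]
    generalize μ i = t at *
    generalize (n:ℝ) = N at *
    have e2 : 1 - (N + 1) / N ^ 2 * (t - 1) - 1 / t ^ 2
        = (t - 1) * (N - t) * (N * t + N + t) / (N ^ 2 * t ^ 2) := by
      have : t ≠ 0 := by linarith
      have : N ≠ 0 := by linarith
      field_simp
      ring
    have : 0 ≤ (t - 1) * (N - t) * (N * t + N + t) / (N ^ 2 * t ^ 2) := by
      have := sub_nonneg.2 h1
      have := sub_nonneg.2 h2
      have : 0 ≤ N := by linarith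
      have : 0 ≤ t := by linarith
      positivity
    linarith
  have hsum := Finset.sum_le_sum hchord
  rw [Finset.sum_sub_distrib, ← Finset.mul_sum, Finset.sum_sub_distrib, htr] at hsum
  simp only [Finset.sum_const, nsmul_eq_mul, mul_one, hcard] at hsum
  have hk : 0 < (1 - 1 / (n:ℝ)^2) / (n - 1) := by
    apply div_pos _ (by linarith)
    have : 1 / (n:ℝ)^2 < 1 := by
      rw [div_lt_one (by positivity)]; nlinarith
    linarith
  have hk2 : (1 - 1 / (n:ℝ)^2) / (n - 1) * (n - 1) = 1 - 1 / (n:ℝ)^2 :=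
    div_mul_cancel₀ _ (by linarith)
  have hn0 : (0:ℝ) < n := by linarith
  generalize (1 - 1 / (n:ℝ)^2) / (n - 1) = k at *
  refine ⟨?_, ?_, ?_⟩
  · apply mul_le_mul_of_nonneg_left _ hn0.le
    nlinarith
  · intro heq
    have heq := mul_left_cancel₀ hn0.ne' heq
    have hle : (#G.edgeFinset : ℝ) + 1 ≤ n := by
      rw [heq] at hsum
      by_contra hc
      push Not at hc
      nlinarith
    have hle' : #G.edgeFinset + 1 = n := le_antisymm (by exact_mod_cast hle) hm
    have htree : G.IsTree := by
      rw [SimpleGraph.isTree_iff_connected_and_card]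
      refine ⟨hG, ?_⟩
      rwa [Nat.card_eq_fintype_card, Nat.card_eq_fintype_card, Fintype.card_fin,
        ← SimpleGraph.edgeFinset_card]
    obtain ⟨c, hc⟩ := aux_tree G htree hd
    exact aux_star_iso G c hc
  · rintro ⟨f⟩
    obtain ⟨c, hc⟩ := aux_iso_star hn G f
    have hE : (#G.edgeFinset : ℝ) + 1 = n := by exact_mod_cast aux_star_edges G c hc
    obtain ⟨v, hv⟩ := aux_star_eig hn G c hc
    rw [he] at hv
    have hmem : e v ∈ univ.erase (0 : Fin n) := by
      simp only [Finset.mem_erase, Finset.mem_univ, and_true]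
      intro h
      rw [h, h0] at hv
      linarith
    have hcard2 : (#((univ.erase (0 : Fin n)).erase (e v)) : ℝ) = n - 2 := by
      have := Finset.card_erase_add_one hmem
      have : (#((univ.erase (0 : Fin n)).erase (e v)) : ℝ) + 1 = #(univ.erase (0 : Fin n)) := by
        exact_mod_cast this
      linarith
    have hone : ∀ i ∈ (univ.erase (0 : Fin n)).erase (e v), μ i - 1 = 0 := by
      rw [← Finset.sum_eq_zero_iff_of_nonneg
        (fun i hi => by linarith [hbd i (Finset.mem_of_mem_erase hi)])]
      rw [Finset.sum_sub_distrib]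
      simp only [Finset.sum_const, nsmul_eq_mul, mul_one, hcard2]
      rw [← Finset.add_sum_erase _ _ hmem] at htr
      linarith
    congr 1
    rw [← Finset.add_sum_erase _ _ hmem, hv,
      Finset.sum_congr rfl (g := fun _ => (1:ℝ))
        (fun i hi => by rw [show μ i = 1 by linarith [hone i hi]]; norm_num)]
    simp only [Finset.sum_const, nsmul_eq_mul, mul_one, hcard2]
    ring
end

section
/- Let F_{0,1,n−3} be the firefly graph with s = 0 triangles, t = 1 pendant path of length 2, and n − 3 pendant edges, on n ≥ 7 vertices. Then the characteristic polynomial of its Laplacian matrix is x(x−1)^{n−4}·[x³ − (n+2)x² + (3n−2)x − n], and BH(F_{0,1,n−3}) = n² + 3n − 16 + 4/n. -/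
open Finset Polynomial

/-- The firefly graph `F_{s,t,k}` on `2s + 2t + k + 1` vertices: vertex `0` is the common
vertex; for each `i` with `1 ≤ i ≤ s` the vertices `2i-1, 2i` together with `0` form a
triangle; for each `j` with `1 ≤ j ≤ t` the vertices `2s+2j-1, 2s+2j` form a pendant path
of length 2 attached at `0` (with `2s+2j-1` the middle vertex); and the `k` vertices
`2s+2t+1, …, 2s+2t+k` are pendant neighbours of `0`. -/
def firefly (s t k : ℕ) : SimpleGraph (Fin (2 * s + 2 * t + k + 1)) :=
  SimpleGraph.fromRel (fun u v =>
    (u.val = 0 ∧ 1 ≤ v.val ∧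
      (v.val ≤ 2 * s ∨ (2 * s < v.val ∧ v.val ≤ 2 * s + 2 * t ∧ Odd (v.val - 2 * s)) ∨
        2 * s + 2 * t < v.val)) ∨
    (Odd u.val ∧ u.val ≤ 2 * s ∧ v.val = u.val + 1) ∨
    (2 * s < u.val ∧ u.val ≤ 2 * s + 2 * t ∧ Odd (u.val - 2 * s) ∧ v.val = u.val + 1))

noncomputable instance (s t k : ℕ) : DecidableRel (firefly s t k).Adj :=
  Classical.decRel _


theorem ff_adj (k : ℕ) (u v : Fin (2 * 0 + 2 * 1 + k + 1)) :
    (firefly 0 1 k).Adj u v ↔ (u.val = 0 ∧ (v.val = 1 ∨ 3 ≤ v.val)) ∨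
      (v.val = 0 ∧ (u.val = 1 ∨ 3 ≤ u.val)) ∨ (u.val = 1 ∧ v.val = 2) ∨
      (u.val = 2 ∧ v.val = 1) := by
  unfold firefly
  rw [SimpleGraph.fromRel_adj, Ne, Fin.ext_iff]
  simp only [Nat.odd_iff]
  omega

def ffe (k : ℕ) : Fin 3 ⊕ Fin k ≃ Fin (2 * 0 + 2 * 1 + k + 1) :=
  finSumFinEquiv.trans (finCongr (by omega))

theorem ffe_inl (k : ℕ) (i : Fin 3) : (ffe k (Sum.inl i)).val = i.val := by
  simp [ffe]

theorem ffe_inr (k : ℕ) (i : Fin k) : (ffe k (Sum.inr i)).val = 3 + i.val := by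
  simp [ffe]

theorem ff_deg (k : ℕ) (u : Fin (2 * 0 + 2 * 1 + k + 1)) :
    ((firefly 0 1 k).degree u : ℝ) =
      if u.val = 0 then (k : ℝ) + 1 else if u.val = 1 then 2 else 1 := by
  have h : ((firefly 0 1 k).degree u : ℝ) =
      ∑ v, if (firefly 0 1 k).Adj u v then (1 : ℝ) else 0 := by
    rw [← SimpleGraph.card_neighborFinset_eq_degree, SimpleGraph.neighborFinset_eq_filter]
    simp
  rw [h, ← (ffe k).sum_comp, Fintype.sum_sum_type, Fin.sum_univ_three]
  simp only [ff_adj, ffe_inl, ffe_inr]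
  by_cases h0 : u.val = 0
  · simp [h0]; ring
  by_cases h1 : u.val = 1
  · have hz : ∀ x : Fin k, 3 + x.val ≠ 2 := fun x => by omega
    simp [h1, hz]; norm_num
  by_cases h2 : u.val = 2
  · have hz : ∀ x : Fin k, 3 + x.val ≠ 1 := fun x => by omega
    simp [h2, hz]
  · have : 3 ≤ u.val := by omega
    simp [h0, h1, h2, this]

theorem ff_lap (k : ℕ) (u v : Fin (2 * 0 + 2 * 1 + k + 1)) :
    (firefly 0 1 k).lapMatrix ℝ u v =
      (if u.val = v.val then (if u.val = 0 then (k : ℝ) + 1 else if u.val = 1 then 2 else 1) else 0)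
      - if ((u.val = 0 ∧ (v.val = 1 ∨ 3 ≤ v.val)) ∨
      (v.val = 0 ∧ (u.val = 1 ∨ 3 ≤ u.val)) ∨ (u.val = 1 ∧ v.val = 2) ∨
      (u.val = 2 ∧ v.val = 1)) then 1 else 0 := by
  rw [← ff_deg]
  simp only [SimpleGraph.lapMatrix, SimpleGraph.degMatrix, Matrix.sub_apply, Matrix.diagonal_apply,
    SimpleGraph.adjMatrix_apply, ff_adj, Fin.ext_iff]

theorem ff_det (k : ℕ) (hk : 1 ≤ k) (x : ℝ) (hx : x ≠ 1) :
    (Matrix.scalar _ x - (firefly 0 1 k).lapMatrix ℝ).det =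
      x * (x - 1) ^ (k - 1) *
        (x ^ 3 - ((k : ℝ) + 3 + 2) * x ^ 2 + (3 * ((k : ℝ) + 3) - 2) * x - ((k : ℝ) + 3)) := by
  have hx' : x - 1 ≠ 0 := sub_ne_zero.mpr hx
  rw [← Matrix.det_submatrix_equiv_self (ffe k)]
  have hb : (Matrix.scalar _ x - (firefly 0 1 k).lapMatrix ℝ).submatrix (ffe k) (ffe k) =
      Matrix.fromBlocks !![x - (k + 1), 1, 0; 1, x - 2, 1; 0, 1, x - 1]
        (Matrix.of fun i _ => if i = 0 then 1 else 0)
        (Matrix.of fun _ i => if i = 0 then 1 else 0)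
        (Matrix.diagonal fun _ => x - 1) := by
    ext i j
    rcases i with i | i <;> rcases j with j | j
    · simp only [Matrix.submatrix_apply, Matrix.sub_apply, ff_lap, ffe_inl, Matrix.scalar_apply,
        Matrix.diagonal_apply, EmbeddingLike.apply_eq_iff_eq, Matrix.fromBlocks_apply₁₁]
      fin_cases i <;> fin_cases j <;> simp
    · simp only [Matrix.submatrix_apply, Matrix.sub_apply, ff_lap, ffe_inl, ffe_inr,
        Matrix.scalar_apply,
        Matrix.diagonal_apply, EmbeddingLike.apply_eq_iff_eq, Matrix.fromBlocks_apply₁₂]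
      have h1 : 3 + j.val ≠ 1 := by omega
      have h2 : 3 + j.val ≠ 2 := by omega
      have h3 : 2 ≠ 3 + j.val := by omega
      have h4 : 1 ≠ 3 + j.val := by omega
      have h5 : 0 ≠ 3 + j.val := by omega
      fin_cases i <;> simp [h1, h2, h3, h4, h5]
    · simp only [Matrix.submatrix_apply, Matrix.sub_apply, ff_lap, ffe_inl, ffe_inr,
        Matrix.scalar_apply,
        Matrix.diagonal_apply, EmbeddingLike.apply_eq_iff_eq, Matrix.fromBlocks_apply₂₁]
      have h1 : 3 + i.val ≠ 1 := by omega
      have h2 : 3 + i.val ≠ 2 := by omega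
      have h3 : 2 ≠ 3 + i.val := by omega
      have h4 : 1 ≠ 3 + i.val := by omega
      fin_cases j <;> simp [h1, h2, h3, h4]
    · simp only [Matrix.submatrix_apply, Matrix.sub_apply, ff_lap, ffe_inl, ffe_inr,
        Matrix.scalar_apply,
        Matrix.diagonal_apply, EmbeddingLike.apply_eq_iff_eq, Matrix.fromBlocks_apply₂₂,
        Sum.inr.injEq]
      have h1 : 3 + i.val ≠ 1 := by omega
      have h2 : 3 + i.val ≠ 2 := by omega
      by_cases h : i = j
      · subst h; simp [h1, h2]
      · have : i.val ≠ j.val := fun h' => h (Fin.ext h')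
        simp [h, h1, h2, this]
  rw [hb]
  letI : Invertible (Matrix.diagonal fun _ : Fin k => x - 1) :=
    ⟨Matrix.diagonal fun _ => (x - 1)⁻¹, by simp [hx'], by simp [hx']⟩
  rw [Matrix.det_fromBlocks₂₂]
  have hinv : ⅟(Matrix.diagonal fun _ : Fin k => x - 1) = Matrix.diagonal fun _ => (x - 1)⁻¹ := rfl
  rw [hinv, Matrix.det_fin_three, Matrix.det_diagonal]
  simp [Matrix.mul_apply, Matrix.diagonal_apply]
  obtain ⟨m, rfl⟩ : ∃ m, k = m + 1 := ⟨k - 1, by omega⟩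
  simp only [Nat.add_sub_cancel, pow_succ]
  push_cast
  field_simp
  ring

theorem ff_charpoly (k : ℕ) (hk : 1 ≤ k) :
    ((firefly 0 1 k).lapMatrix ℝ).charpoly =
      X * (X - 1) ^ (k - 1) *
        (X ^ 3 - C ((k : ℝ) + 3 + 2) * X ^ 2 + C (3 * ((k : ℝ) + 3) - 2) * X
          - C ((k : ℝ) + 3)) := by
  apply Polynomial.eq_of_infinite_eval_eq
  apply Set.Infinite.mono (s := {1}ᶜ)
  · intro x hx
    have := ff_det k hk x hx
    simp only [Set.mem_ofPred_eq, Matrix.eval_charpoly, this]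
    simp
  · exact (Set.finite_singleton _).infinite_compl

theorem statement_12 {n k : ℕ} (hn : 7 ≤ n) (hk : n = k + 3)
    (μ : Fin (2 * 0 + 2 * 1 + k + 1) → ℝ) (hμ : IsLapEigSeq (firefly 0 1 k) μ) :
    ((firefly 0 1 k).lapMatrix ℝ).charpoly =
      X * (X - 1) ^ (n - 4) *
        (X ^ 3 - C ((n : ℝ) + 2) * X ^ 2 + C (3 * (n : ℝ) - 2) * X - C (n : ℝ)) ∧
    (n : ℝ) * ∑ i ∈ univ.filter (fun i : Fin (2 * 0 + 2 * 1 + k + 1) => 0 < i.val), 1 / μ i ^ 2 = (n : ℝ) ^ 2 + 3 * (n : ℝ) - 16 + 4 / (n : ℝ) := by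
  have hcp := ff_charpoly k (by omega)
  have hn4 : n - 4 = k - 1 := by omega
  have hnk : (n : ℝ) = k + 3 := by rw [hk]; push_cast; ring
  rw [← hnk, ← hn4] at hcp
  refine ⟨hcp, ?_⟩
  obtain ⟨hmono, e, he⟩ := hμ
  set S := univ.filter (fun i : Fin (2 * 0 + 2 * 1 + k + 1) => 0 < i.val) with hS
  have hn0 : (7 : ℝ) ≤ n := by exact_mod_cast hn
  have hprod : ((firefly 0 1 k).lapMatrix ℝ).charpoly = ∏ i, (X - C (μ i)) := by
    rw [(SimpleGraph.posSemidef_lapMatrix (R := ℝ) (G := firefly 0 1 k)).1.charpoly_eq,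
      ← e.prod_comp (fun i => X - C (μ i))]
    refine Finset.prod_congr rfl fun v _ => ?_
    rw [← he v]; rfl
  have hnonneg : ∀ i, 0 ≤ μ i := by
    intro i
    obtain ⟨v, rfl⟩ := e.surjective i
    rw [← he v]
    exact (SimpleGraph.posSemidef_lapMatrix (R := ℝ) (G := firefly 0 1 k)).eigenvalues_nonneg v
  have hμ0 : μ 0 = 0 := by
    have h := congrArg (Polynomial.eval 0) (hprod.symm.trans hcp)
    simp only [eval_prod, eval_mul, eval_X, zero_mul] at h
    obtain ⟨i, -, hi⟩ := Finset.prod_eq_zero_iff.mp h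
    have hi' : μ i = 0 := by simpa using hi
    exact le_antisymm (hi' ▸ hmono (Fin.zero_le i)) (hnonneg 0)
  have hSe : S = univ.erase 0 := by
    ext i
    rw [hS, mem_filter, mem_erase, Ne, Fin.ext_iff]
    simp only [mem_univ, true_and, and_true, Fin.val_zero]
    omega
  set q : ℝ[X] := X ^ 3 - C ((n : ℝ) + 2) * X ^ 2 + C (3 * (n : ℝ) - 2) * X - C (n : ℝ) with hq
  have hQ : ∏ i ∈ S, (X - C (μ i)) = (X - 1) ^ (n - 4) * q := by
    have h := hprod.symm.trans hcp
    rw [← Finset.mul_prod_erase univ _ (mem_univ 0), hμ0, ← hSe, C_0, sub_zero, mul_assoc] at h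
    exact mul_left_cancel₀ X_ne_zero h
  have hqdeg : q.natDegree = 3 := by rw [hq]; compute_degree!
  have hqm : q.Monic := by rw [hq]; monicity!
  have hsp : q.Splits := by
    have h1 : (∏ i ∈ S, (X - C (μ i))).Splits := Polynomial.Splits.prod fun i _ => Polynomial.Splits.X_sub_C _
    refine Polynomial.Splits.of_dvd h1 ?_ (hQ ▸ Dvd.intro_left _ rfl)
    exact (Polynomial.monic_prod_of_monic _ _ fun i _ => monic_X_sub_C _).ne_zero
  have hcard : q.roots.card = 3 := by rw [← hsp.natDegree_eq_card_roots, hqdeg]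
  obtain ⟨a, b, c, habc⟩ := Multiset.card_eq_three.mp hcard
  have hqf : q = (X - C a) * (X - C b) * (X - C c) := by
    rw [hsp.eq_prod_roots_of_monic hqm, habc]
    simp [mul_assoc]
  have hroots : S.val.map μ = Multiset.replicate (n - 4) 1 + {a, b, c} := by
    have h := congrArg Polynomial.roots hQ
    have h2 : (∏ i ∈ S, (X - C (μ i))).roots = S.val.map μ := by
      have h3 : ∏ i ∈ S, (X - C (μ i)) = ((S.val.map μ).map fun a => X - C a).prod := by
        rw [Multiset.map_map]; rfl
      rw [h3, roots_multiset_prod_X_sub_C]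
    rw [h2, roots_mul, roots_pow, ← C_1, roots_X_sub_C, habc, Multiset.nsmul_singleton] at h
    · exact h
    · exact mul_ne_zero (pow_ne_zero _ (by rw [← C_1]; exact X_sub_C_ne_zero 1)) hqm.ne_zero
  have hsum : ∑ i ∈ S, 1 / μ i ^ 2 = (n - 4 : ℕ) + (1 / a ^ 2 + 1 / b ^ 2 + 1 / c ^ 2) := by
    have : ∑ i ∈ S, 1 / μ i ^ 2 = ((S.val.map μ).map fun y => 1 / y ^ 2).sum := by
      rw [Multiset.map_map]; rfl
    rw [this, hroots]
    simp
    ring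
  have e0 := congrArg (Polynomial.eval 0) hqf
  have e1 := congrArg (Polynomial.eval 1) hqf
  have e2 := congrArg (Polynomial.eval (-1)) hqf
  simp [hq] at e0 e1 e2
  have p3 : a * b * c = n := by linarith
  have p2 : a * b + b * c + c * a = 3 * n - 2 := by linarith
  have p1 : a + b + c = n + 2 := by linarith
  have hnz : (n : ℝ) ≠ 0 := by linarith
  have ha : a ≠ 0 := by rintro rfl; simp at p3; exact hnz p3.symm
  have hb : b ≠ 0 := by rintro rfl; simp at p3; exact hnz p3.symm
  have hc : c ≠ 0 := by rintro rfl; simp at p3; exact hnz p3.symm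
  have key : 1 / a ^ 2 + 1 / b ^ 2 + 1 / c ^ 2 =
      ((a * b + b * c + c * a) ^ 2 - 2 * (a * b * c) * (a + b + c)) / (a * b * c) ^ 2 := by
    field_simp
    ring
  rw [hsum, key, p1, p2, p3, Nat.cast_sub (by omega)]
  push_cast
  field_simp
  ring
end

section
/- Let F_{0,t,n−2t−1} be the firefly graph with s = 0 triangles, t ≥ 2 pendant paths of length 2, and n − 2t − 1 pendant edges, on n ≥ 7 vertices. Then BH(F_{0,t,n−2t−1}) = n² − 2n + (9t² + (5n² − 16n − 6)t + 1)/n. Consequently: if n is odd then n² + 8n + 25/n − 32 ≤ BH(F_{0,t,n−2t−1}) ≤ 7n²/2 − 41n/4 + 25/(4n) + 1/2, with the lower bound attained exactly at t = 2 and the upper bound exactly at t = (n−1)/2; if n is even then n² + 8n + 25/n − 32 ≤ BH(F_{0,t,n−2t−1}) ≤ 7n²/2 − 51n/4 + 16/n + 4, with the lower bound attained exactly at t = 2 and the upper bound exactly at t = (n−2)/2. -/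
open Finset Polynomial

namespace FF
open Matrix

theorem trace_pinv {V : Type*} [Fintype V] [DecidableEq V] {A M P : Matrix V V ℝ}
    (hA : A.IsHermitian) (h1 : M * A = P) (h2 : A * M = P) (h3 : P * A = A) (h3' : A * P = A)
    (h4 : M * P = M) :
    (M * M).trace = ∑ i, 1 / hA.eigenvalues i ^ 2 := by
  set U : Matrix V V ℝ := (hA.eigenvectorUnitary : Matrix V V ℝ) with hU
  have hUU : star U * U = 1 := Unitary.coe_star_mul_self hA.eigenvectorUnitary
  set D : Matrix V V ℝ := diagonal hA.eigenvalues with hD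
  set E : Matrix V V ℝ := diagonal (fun i => (hA.eigenvalues i)⁻¹) with hE
  have hspec : A = U * D * star U := by
    have := hA.spectral_theorem
    rw [Unitary.conjStarAlgAut_apply] at this
    simpa [Function.comp_def] using this
  have hDED : D * E * D = D := by
    rw [hD, hE, diagonal_mul_diagonal, diagonal_mul_diagonal]
    congr 1; ext i
    by_cases h : hA.eigenvalues i = 0 <;> simp [h]
  have hDEE : D * E * E = E := by
    rw [hD, hE, diagonal_mul_diagonal, diagonal_mul_diagonal]
    congr 1; ext i
    by_cases h : hA.eigenvalues i = 0 <;> simp [h]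
  have hEED : E * E * D = E := by
    rw [hD, hE, diagonal_mul_diagonal, diagonal_mul_diagonal]
    congr 1; ext i
    by_cases h : hA.eigenvalues i = 0 <;> simp [h]
  have conj : ∀ B C : Matrix V V ℝ, (U * B * star U) * (U * C * star U) = U * (B * C) * star U := by
    intro B C
    calc _ = U * B * (star U * U) * C * star U := by simp only [Matrix.mul_assoc]
      _ = _ := by rw [hUU]; simp only [Matrix.mul_assoc, Matrix.one_mul]
  set X := U * E * star U with hX
  have hAXA : A * X * A = A := by
    rw [hspec, hX, conj, conj, hDED]
  have hAXX : A * X * X = X := by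
    rw [hspec, hX, conj, conj, hDEE]
  have hXXA : X * X * A = X := by
    rw [hspec, hX, conj, conj, hEED]
  have hPX : P * X = X := by
    calc P * X = P * (A * X * X) := by rw [hAXX]
      _ = P * A * X * X := by simp only [Matrix.mul_assoc]
      _ = X := by rw [h3, hAXX]
  have hXP : X * P = X := by
    calc X * P = (X * X * A) * P := by rw [hXXA]
      _ = X * X * (A * P) := by simp only [Matrix.mul_assoc]
      _ = X := by rw [h3', hXXA]
  have hMX : M = X := by
    calc M = M * P := h4.symm
      _ = M * (A * X * A) * M := by rw [hAXA, ← h2]; simp only [Matrix.mul_assoc]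
      _ = (M * A) * X * (A * M) := by simp only [Matrix.mul_assoc]
      _ = X := by rw [h1, h2, hPX, hXP]
  rw [hMX, hX, conj, Matrix.trace_mul_comm, ← Matrix.mul_assoc, hUU, Matrix.one_mul, hE,
    diagonal_mul_diagonal, Matrix.trace_diagonal]
  refine Finset.sum_congr rfl fun i _ => ?_
  rw [one_div, pow_two, mul_inv]

abbrev W (t k : ℕ) := Unit ⊕ ((Fin t ⊕ Fin t) ⊕ Fin k)

def f (t k : ℕ) : W t k → Fin (2 * 0 + 2 * t + k + 1)
  | .inl _ => ⟨0, by omega⟩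
  | .inr (.inl (.inl i)) => ⟨2 * i + 1, by omega⟩
  | .inr (.inl (.inr i)) => ⟨2 * i + 2, by omega⟩
  | .inr (.inr j) => ⟨2 * t + 1 + j, by omega⟩

theorem f_bij (t k : ℕ) : Function.Bijective (f t k) := by
  rw [Fintype.bijective_iff_injective_and_card]
  constructor
  · rintro (_ | (i | i) | i) (_ | (j | j) | j) h <;> simp [f, Fin.ext_iff] at h ⊢ <;> omega
  · simp; omega

noncomputable def e (t k : ℕ) : W t k ≃ Fin (2 * 0 + 2 * t + k + 1) :=
  Equiv.ofBijective _ (f_bij t k)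

def adj (t k : ℕ) : W t k → W t k → Prop
  | .inl _, .inr (.inl (.inl _)) => True
  | .inl _, .inr (.inr _) => True
  | .inr (.inl (.inl _)), .inl _ => True
  | .inr (.inr _), .inl _ => True
  | .inr (.inl (.inl i)), .inr (.inl (.inr j)) => i = j
  | .inr (.inl (.inr i)), .inr (.inl (.inl j)) => i = j
  | _, _ => False

theorem adj_iff (t k : ℕ) (u v : W t k) :
    (firefly 0 t k).Adj (f t k u) (f t k v) ↔ adj t k u v := by
  rcases u with (_ | (i | i) | i) <;> rcases v with (_ | (j | j) | j) <;>
    simp only [f, adj, firefly, SimpleGraph.fromRel_adj, ne_eq, Fin.ext_iff, Nat.odd_iff, iff_true, iff_false,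
      Nat.mul_zero, Nat.zero_add, Nat.sub_zero, true_and] <;> omega

def Am (t k : ℕ) : W t k → W t k → ℝ
  | .inl _, .inr (.inl (.inl _)) => 1
  | .inl _, .inr (.inr _) => 1
  | .inr (.inl (.inl _)), .inl _ => 1
  | .inr (.inr _), .inl _ => 1
  | .inr (.inl (.inl i)), .inr (.inl (.inr j)) => if i = j then 1 else 0
  | .inr (.inl (.inr i)), .inr (.inl (.inl j)) => if i = j then 1 else 0
  | _, _ => 0

theorem adjM (t k : ℕ) (u v : W t k) :
    (firefly 0 t k).adjMatrix ℝ (f t k u) (f t k v) = Am t k u v := by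
  rw [SimpleGraph.adjMatrix_apply]
  have := adj_iff t k u v
  by_cases h : adj t k u v
  · rw [if_pos (this.2 h)]
    rcases u with (_ | (i | i) | i) <;> rcases v with (_ | (j | j) | j) <;> simp_all [adj, Am]
  · rw [if_neg (fun h' => h (this.1 h'))]
    rcases u with (_ | (i | i) | i) <;> rcases v with (_ | (j | j) | j) <;> simp_all [adj, Am]

def dg (t k : ℕ) : W t k → ℝ
  | .inl _ => t + k
  | .inr (.inl (.inl _)) => 2
  | .inr (.inl (.inr _)) => 1
  | .inr (.inr _) => 1

def Lm (t k : ℕ) : Matrix (W t k) (W t k) ℝ :=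
  Matrix.of fun u v => (if u = v then dg t k u else 0) - Am t k u v

def Nm (t k : ℕ) : Matrix (W t k) (W t k) ℝ := Matrix.of fun u v => match u, v with
  | .inr (.inl (.inl i)), .inr (.inl (.inl j)) => if i = j then 1 else 0
  | .inr (.inl (.inl i)), .inr (.inl (.inr j)) => if i = j then 1 else 0
  | .inr (.inl (.inr i)), .inr (.inl (.inl j)) => if i = j then 1 else 0
  | .inr (.inl (.inr i)), .inr (.inl (.inr j)) => if i = j then 2 else 0
  | .inr (.inr i), .inr (.inr j) => if i = j then 1 else 0
  | _, _ => 0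

theorem lap_sub (t k : ℕ) : ((firefly 0 t k).lapMatrix ℝ).submatrix (e t k) (e t k) = Lm t k := by
  have hdeg : ∀ u, (((firefly 0 t k).degree (e t k u) : ℕ) : ℝ) = dg t k u := by
    intro u
    have h0 : ∑ x, (firefly 0 t k).adjMatrix ℝ (e t k u) x = ((firefly 0 t k).degree (e t k u) : ℝ) := by
      have := SimpleGraph.adjMatrix_mulVec_const_apply (G := firefly 0 t k) (a := (1:ℝ)) (v := e t k u)
      simpa [Matrix.mulVec, dotProduct] using this
    rw [← h0, ← (e t k).sum_comp]
    have : ∀ v, (firefly 0 t k).adjMatrix ℝ (e t k u) (e t k v) = Am t k u v := adjM t k u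
    simp only [this]
    rcases u with (_ | (i | i) | i) <;> simp [Am, dg, Fintype.sum_sum_type]
    norm_num
  ext u v
  have h : (firefly 0 t k).adjMatrix ℝ (e t k u) (e t k v) = Am t k u v := adjM t k u v
  simp only [SimpleGraph.lapMatrix, Matrix.submatrix_apply, Matrix.sub_apply, h, Lm, Matrix.of_apply,
    SimpleGraph.degMatrix, Matrix.diagonal_apply, hdeg, EmbeddingLike.apply_eq_iff_eq]

def Jm (t k : ℕ) : Matrix (W t k) (W t k) ℝ := Matrix.of fun _ _ => 1

def Em (t k : ℕ) : Matrix (W t k) (W t k) ℝ := Matrix.of fun _ v => if v = .inl () then 1 else 0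

theorem NL (t k : ℕ) : Nm t k * Lm t k = 1 - Em t k := by
  ext u v
  rw [Matrix.mul_apply]
  rcases u with (_ | (i | i) | i) <;> rcases v with (_ | (j | j) | j) <;>
    simp [Nm, Lm, Em, Am, dg, Fintype.sum_sum_type, Matrix.one_apply, ite_mul, mul_sub,
      Finset.sum_sub_distrib] <;> (try split_ifs) <;> (try norm_num)

theorem LJ (t k : ℕ) : Lm t k * Jm t k = 0 := by
  ext u v
  rw [Matrix.mul_apply]
  rcases u with (_ | (i | i) | i) <;>
    simp [Lm, Jm, Am, dg, Fintype.sum_sum_type, Finset.sum_sub_distrib] <;> (try norm_num)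

theorem Lsymm (t k : ℕ) : (Lm t k)ᵀ = Lm t k := by
  ext u v
  rcases u with (_ | (i | i) | i) <;> rcases v with (_ | (j | j) | j) <;>
    simp [Lm, Am, dg, eq_comm]

theorem Nsymm (t k : ℕ) : (Nm t k)ᵀ = Nm t k := by
  ext u v
  rcases u with (_ | (i | i) | i) <;> rcases v with (_ | (j | j) | j) <;>
    simp [Nm, eq_comm]

theorem Jsymm (t k : ℕ) : (Jm t k)ᵀ = Jm t k := by
  ext u v; simp [Jm]

theorem JJ (t k : ℕ) : Jm t k * Jm t k = ((2 * t + k + 1 : ℕ) : ℝ) • Jm t k := by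
  ext u v
  simp [Jm, Matrix.mul_apply]; ring

theorem JE (t k : ℕ) : Jm t k * Em t k = ((2 * t + k + 1 : ℕ) : ℝ) • Em t k := by
  ext u v
  simp [Jm, Em, Matrix.mul_apply]
  split_ifs <;> ring_nf

theorem trNN (t k : ℕ) : (Nm t k * Nm t k).trace = 7 * t + k := by
  simp [Matrix.trace, Matrix.mul_apply, Nm, Fintype.sum_sum_type, Finset.sum_add_distrib]
  ring

def r (t k : ℕ) : W t k → ℝ
  | .inl _ => 0
  | .inr (.inl (.inl _)) => 2
  | .inr (.inl (.inr _)) => 3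
  | .inr (.inr _) => 1

theorem NJ (t k : ℕ) : Nm t k * Jm t k = Matrix.of fun u _ => r t k u := by
  ext u v
  rw [Matrix.mul_apply]
  rcases u with (_ | (i | i) | i) <;>
    simp [Nm, Jm, r, Fintype.sum_sum_type] <;> (try norm_num)

theorem JN (t k : ℕ) : Jm t k * Nm t k = Matrix.of fun _ v => r t k v := by
  have := congrArg Matrix.transpose (NJ t k)
  rw [Matrix.transpose_mul, Nsymm, Jsymm] at this
  rw [this]; rfl

theorem trNNJ (t k : ℕ) : (Nm t k * Nm t k * Jm t k).trace = 13 * t + k := by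
  rw [Matrix.mul_assoc, Matrix.trace_mul_comm, NJ]
  rw [Matrix.trace]
  simp only [Matrix.diag_apply, Matrix.mul_apply, Matrix.of_apply, ← Finset.mul_sum]
  have h : ∀ v, ∑ u, Nm t k u v = r t k v := by
    intro v
    have := congrFun (congrFun (JN t k) v) v
    simpa [Matrix.mul_apply, Jm] using this
  simp only [h]
  simp [r, Fintype.sum_sum_type]
  ring

theorem trNJNJ (t k : ℕ) : (Nm t k * Jm t k * (Nm t k * Jm t k)).trace = (5 * t + k) ^ 2 := by
  rw [NJ, Matrix.trace]
  simp only [Matrix.diag_apply, Matrix.mul_apply, Matrix.of_apply, ← Finset.mul_sum]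
  rw [← Finset.sum_mul]
  simp [r, Fintype.sum_sum_type]
  ring

noncomputable def Pm (t k : ℕ) : Matrix (W t k) (W t k) ℝ :=
  1 - ((2 * t + k + 1 : ℕ) : ℝ)⁻¹ • Jm t k

theorem PP (t k : ℕ) : Pm t k * Pm t k = Pm t k := by
  have h : ((2 * t + k + 1 : ℕ) : ℝ) ≠ 0 := by positivity
  have : Jm t k * Pm t k = 0 := by
    rw [Pm, Matrix.mul_sub, Matrix.mul_smul, JJ, smul_smul, inv_mul_cancel₀ h]; simp
  calc Pm t k * Pm t k = Pm t k - ((2 * t + k + 1 : ℕ) : ℝ)⁻¹ • (Jm t k * Pm t k) := by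
        conv_lhs => rw [show Pm t k * Pm t k = (1 - ((2 * t + k + 1 : ℕ) : ℝ)⁻¹ • Jm t k) * Pm t k from rfl]
        rw [Matrix.sub_mul, Matrix.smul_mul, Matrix.one_mul]
    _ = Pm t k := by rw [this]; simp

theorem PE (t k : ℕ) : Pm t k * Em t k = 0 := by
  have h : ((2 * t + k + 1 : ℕ) : ℝ) ≠ 0 := by positivity
  rw [Pm, Matrix.sub_mul, Matrix.smul_mul, JE, smul_smul, inv_mul_cancel₀ h]; simp

theorem LP (t k : ℕ) : Lm t k * Pm t k = Lm t k := by
  rw [Pm, Matrix.mul_sub, Matrix.mul_smul, LJ]; simp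

theorem Psymm (t k : ℕ) : (Pm t k)ᵀ = Pm t k := by
  rw [Pm, Matrix.transpose_sub, Matrix.transpose_smul, Jsymm, Matrix.transpose_one]

theorem PL (t k : ℕ) : Pm t k * Lm t k = Lm t k := by
  have := congrArg Matrix.transpose (LP t k)
  rwa [Matrix.transpose_mul, Lsymm, Psymm] at this

noncomputable def Mm (t k : ℕ) : Matrix (W t k) (W t k) ℝ := Pm t k * Nm t k * Pm t k

theorem ML (t k : ℕ) : Mm t k * Lm t k = Pm t k := by
  rw [Mm, Matrix.mul_assoc, PL, Matrix.mul_assoc, NL, Matrix.mul_sub, PE]; simp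

theorem LM (t k : ℕ) : Lm t k * Mm t k = Pm t k := by
  have := congrArg Matrix.transpose (ML t k)
  rw [Matrix.transpose_mul, Lsymm, Psymm, Mm, Matrix.transpose_mul, Matrix.transpose_mul,
    Nsymm, Psymm, ← Matrix.mul_assoc (Pm t k)] at this
  exact this

theorem MP (t k : ℕ) : Mm t k * Pm t k = Mm t k := by
  rw [Mm, Matrix.mul_assoc, PP]

theorem trMM (t k : ℕ) : (Mm t k * Mm t k).trace =
    (7 * t + k) - 2 * ((2 * t + k + 1 : ℕ) : ℝ)⁻¹ * (13 * t + k)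
      + (((2 * t + k + 1 : ℕ) : ℝ)⁻¹) ^ 2 * (5 * t + k) ^ 2 := by
  have h1 : (Mm t k * Mm t k).trace = (Nm t k * Pm t k * (Nm t k * Pm t k)).trace := by
    calc _ = (Pm t k * (Nm t k * (Pm t k * Pm t k) * Nm t k * Pm t k)).trace := by
          simp only [Mm, Matrix.mul_assoc]
      _ = (Nm t k * Pm t k * Nm t k * (Pm t k * Pm t k)).trace := by
          rw [Matrix.trace_mul_comm, PP]; simp only [Matrix.mul_assoc, PP]
      _ = _ := by rw [PP]; simp only [Matrix.mul_assoc]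
  have h2 : (Nm t k * Jm t k * Nm t k).trace = 13 * t + k := by
    rw [Matrix.trace_mul_comm, ← Matrix.mul_assoc, trNNJ]
  have h3 : Nm t k * Pm t k = Nm t k - ((2 * t + k + 1 : ℕ) : ℝ)⁻¹ • (Nm t k * Jm t k) := by
    rw [Pm, Matrix.mul_sub, Matrix.mul_smul, Matrix.mul_one]
  rw [h1, h3, Matrix.sub_mul, Matrix.mul_sub, Matrix.mul_sub]
  simp only [Matrix.smul_mul, Matrix.mul_smul, Matrix.trace_sub, Matrix.trace_smul, smul_eq_mul,
    trNJNJ, trNN, h2, ← Matrix.mul_assoc (Nm t k) (Nm t k), trNNJ]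
  ring

theorem main_sum (t k : ℕ) (μ : Fin (2 * 0 + 2 * t + k + 1) → ℝ)
    (hμ : IsLapEigSeq (firefly 0 t k) μ) :
    ∑ i ∈ univ.filter (fun i : Fin (2 * 0 + 2 * t + k + 1) => 0 < i.val), 1 / μ i ^ 2 =
    (7 * t + k) - 2 * ((2 * t + k + 1 : ℕ) : ℝ)⁻¹ * (13 * t + k)
      + (((2 * t + k + 1 : ℕ) : ℝ)⁻¹) ^ 2 * (5 * t + k) ^ 2 := by
  obtain ⟨hmono, σ, hσ⟩ := hμ
  set hps := SimpleGraph.posSemidef_lapMatrix (R := ℝ) (G := firefly 0 t k)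
  have hL : (firefly 0 t k).lapMatrix ℝ = (Lm t k).submatrix (e t k).symm (e t k).symm := by
    rw [← lap_sub]; ext u v; simp
  have key := trace_pinv (A := (firefly 0 t k).lapMatrix ℝ)
    (M := (Mm t k).submatrix (e t k).symm (e t k).symm)
    (P := (Pm t k).submatrix (e t k).symm (e t k).symm) hps.1
    (by rw [hL, Matrix.submatrix_mul_equiv, ML]) (by rw [hL, Matrix.submatrix_mul_equiv, LM])
    (by rw [hL, Matrix.submatrix_mul_equiv, PL]) (by rw [hL, Matrix.submatrix_mul_equiv, LP])
    (by rw [Matrix.submatrix_mul_equiv, MP])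
  have htr : ∀ B : Matrix (W t k) (W t k) ℝ,
      (B.submatrix (e t k).symm (e t k).symm).trace = B.trace := by
    intro B
    simp only [Matrix.trace, Matrix.diag_apply, Matrix.submatrix_apply]
    exact (e t k).symm.sum_comp (fun i => B i i)
  rw [Matrix.submatrix_mul_equiv, htr, trMM] at key
  rw [key]
  have hall : ∑ i, 1 / hps.1.eigenvalues i ^ 2 = ∑ i, 1 / μ i ^ 2 := by
    rw [← σ.sum_comp (fun i => 1 / μ i ^ 2)]
    exact Finset.sum_congr rfl fun i _ => by rw [← hσ i]; rfl
  have hnn : ∀ i, 0 ≤ μ i := by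
    intro i
    have := hps.eigenvalues_nonneg (σ.symm i)
    have h2 := hσ (σ.symm i)
    rw [σ.apply_symm_apply] at h2
    rw [← h2]; exact this
  have hz : ∃ i, μ i = 0 := by
    by_contra! hne
    have hdet : ((firefly 0 t k).lapMatrix ℝ).det = 0 := SimpleGraph.det_lapMatrix_eq_zero (firefly 0 t k)
    rw [hps.1.det_eq_prod_eigenvalues] at hdet
    obtain ⟨i, -, hi⟩ := Finset.prod_eq_zero_iff.1 hdet
    apply hne (σ i)
    rw [← hσ i]
    exact_mod_cast hi
  have h0 : μ 0 = 0 := by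
    obtain ⟨i, hi⟩ := hz
    exact le_antisymm (hi ▸ hmono (Fin.zero_le i)) (hnn 0)
  rw [hall]
  refine Finset.sum_subset (Finset.filter_subset _ _) fun i _ hi => ?_
  have : i = 0 := by
    rw [Fin.ext_iff]
    simpa using hi
  rw [this, h0]; simp

end FF

theorem statement_13 {n t k : ℕ} (hn : 7 ≤ n) (ht : 2 ≤ t) (hk : n = 2 * t + k + 1)
    (μ : Fin (2 * 0 + 2 * t + k + 1) → ℝ) (hμ : IsLapEigSeq (firefly 0 t k) μ) :
    (n : ℝ) * ∑ i ∈ univ.filter (fun i : Fin (2 * 0 + 2 * t + k + 1) => 0 < i.val), 1 / μ i ^ 2 = (n : ℝ) ^ 2 - 2 * (n : ℝ) + (9 * (t : ℝ) ^ 2 + (5 * (n : ℝ) ^ 2 - 16 * (n : ℝ) - 6) * (t : ℝ) + 1) / (n : ℝ) ∧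
    (Odd n →
      ((n : ℝ) ^ 2 + 8 * (n : ℝ) + 25 / (n : ℝ) - 32 ≤ (n : ℝ) * ∑ i ∈ univ.filter (fun i : Fin (2 * 0 + 2 * t + k + 1) => 0 < i.val), 1 / μ i ^ 2 ∧
       (n : ℝ) * ∑ i ∈ univ.filter (fun i : Fin (2 * 0 + 2 * t + k + 1) => 0 < i.val), 1 / μ i ^ 2 ≤ 7 * (n : ℝ) ^ 2 / 2 - 41 * (n : ℝ) / 4 + 25 / (4 * (n : ℝ)) + 1 / 2 ∧
       ((n : ℝ) * ∑ i ∈ univ.filter (fun i : Fin (2 * 0 + 2 * t + k + 1) => 0 < i.val), 1 / μ i ^ 2 = (n : ℝ) ^ 2 + 8 * (n : ℝ) + 25 / (n : ℝ) - 32 ↔ t = 2) ∧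
       ((n : ℝ) * ∑ i ∈ univ.filter (fun i : Fin (2 * 0 + 2 * t + k + 1) => 0 < i.val), 1 / μ i ^ 2 = 7 * (n : ℝ) ^ 2 / 2 - 41 * (n : ℝ) / 4 + 25 / (4 * (n : ℝ)) + 1 / 2 ↔ n = 2 * t + 1))) ∧
    (Even n →
      ((n : ℝ) ^ 2 + 8 * (n : ℝ) + 25 / (n : ℝ) - 32 ≤ (n : ℝ) * ∑ i ∈ univ.filter (fun i : Fin (2 * 0 + 2 * t + k + 1) => 0 < i.val), 1 / μ i ^ 2 ∧
       (n : ℝ) * ∑ i ∈ univ.filter (fun i : Fin (2 * 0 + 2 * t + k + 1) => 0 < i.val), 1 / μ i ^ 2 ≤ 7 * (n : ℝ) ^ 2 / 2 - 51 * (n : ℝ) / 4 + 16 / (n : ℝ) + 4 ∧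
       ((n : ℝ) * ∑ i ∈ univ.filter (fun i : Fin (2 * 0 + 2 * t + k + 1) => 0 < i.val), 1 / μ i ^ 2 = (n : ℝ) ^ 2 + 8 * (n : ℝ) + 25 / (n : ℝ) - 32 ↔ t = 2) ∧
       ((n : ℝ) * ∑ i ∈ univ.filter (fun i : Fin (2 * 0 + 2 * t + k + 1) => 0 < i.val), 1 / μ i ^ 2 = 7 * (n : ℝ) ^ 2 / 2 - 51 * (n : ℝ) / 4 + 16 / (n : ℝ) + 4 ↔ n = 2 * t + 2))) := by
  rw [FF.main_sum t k μ hμ]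
  have hkr : (k : ℝ) = n - 2 * t - 1 := by rw [hk]; push_cast; ring
  rw [← hk, hkr]
  have hn0 : (0 : ℝ) < n := by positivity
  have hn7 : (7 : ℝ) ≤ n := by exact_mod_cast hn
  have ht2 : (2 : ℝ) ≤ t := by exact_mod_cast ht
  have main : (n : ℝ) * (7 * t + (n - 2 * t - 1) - 2 * (n : ℝ)⁻¹ * (13 * t + (n - 2 * t - 1)) +
      (n : ℝ)⁻¹ ^ 2 * (5 * t + (n - 2 * t - 1)) ^ 2) = (n : ℝ) ^ 2 - 2 * (n : ℝ) + (9 * (t : ℝ) ^ 2 + (5 * (n : ℝ) ^ 2 - 16 * (n : ℝ) - 6) * (t : ℝ) + 1) / (n : ℝ) := by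
    field_simp; ring
  rw [main]
  set B := (n : ℝ) ^ 2 - 2 * (n : ℝ) + (9 * (t : ℝ) ^ 2 + (5 * (n : ℝ) ^ 2 - 16 * (n : ℝ) - 6) * (t : ℝ) + 1) / (n : ℝ) with hB
  -- difference formula: for a parameter `c`
  have diff : ∀ c : ℝ, (n : ℝ) ^ 2 - 2 * (n : ℝ) + (9 * c ^ 2 + (5 * (n : ℝ) ^ 2 - 16 * (n : ℝ) - 6) * c + 1) / (n : ℝ) - B
      = (c - t) * ((9 * (c + t) + (5 * (n : ℝ) ^ 2 - 16 * (n : ℝ) - 6)) / n) := by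
    intro c; rw [hB]; field_simp; ring
  have pos : ∀ c : ℝ, 0 ≤ c → 0 < (9 * (c + t) + (5 * (n : ℝ) ^ 2 - 16 * (n : ℝ) - 6)) / n := by
    intro c hc
    apply div_pos _ hn0
    nlinarith
  have eqc : ∀ c : ℝ, 0 ≤ c → (B = (n : ℝ) ^ 2 - 2 * (n : ℝ) + (9 * c ^ 2 + (5 * (n : ℝ) ^ 2 - 16 * (n : ℝ) - 6) * c + 1) / (n : ℝ) ↔ (t : ℝ) = c) := by
    intro c hc
    rw [eq_comm, ← sub_eq_zero, diff c, mul_eq_zero, or_iff_left (pos c hc).ne', sub_eq_zero, eq_comm]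
  have lec : ∀ c : ℝ, (t : ℝ) ≤ c → B ≤ (n : ℝ) ^ 2 - 2 * (n : ℝ) + (9 * c ^ 2 + (5 * (n : ℝ) ^ 2 - 16 * (n : ℝ) - 6) * c + 1) / (n : ℝ) := by
    intro c hc
    rw [← sub_nonneg, diff c]
    exact mul_nonneg (by linarith) (pos c (by linarith)).le
  have e2 : (n : ℝ) ^ 2 + 8 * (n : ℝ) + 25 / (n : ℝ) - 32 = (n : ℝ) ^ 2 - 2 * (n : ℝ) + (9 * 2 ^ 2 + (5 * (n : ℝ) ^ 2 - 16 * (n : ℝ) - 6) * 2 + 1) / (n : ℝ) := by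
    field_simp; ring
  have eo : 7 * (n : ℝ) ^ 2 / 2 - 41 * (n : ℝ) / 4 + 25 / (4 * (n : ℝ)) + 1 / 2 = (n : ℝ) ^ 2 - 2 * (n : ℝ) + (9 * (((n : ℝ) - 1) / 2) ^ 2 + (5 * (n : ℝ) ^ 2 - 16 * (n : ℝ) - 6) * (((n : ℝ) - 1) / 2) + 1) / (n : ℝ) := by
    field_simp; ring
  have ee : 7 * (n : ℝ) ^ 2 / 2 - 51 * (n : ℝ) / 4 + 16 / (n : ℝ) + 4 = (n : ℝ) ^ 2 - 2 * (n : ℝ) + (9 * (((n : ℝ) - 2) / 2) ^ 2 + (5 * (n : ℝ) ^ 2 - 16 * (n : ℝ) - 6) * (((n : ℝ) - 2) / 2) + 1) / (n : ℝ) := by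
    field_simp; ring
  have low : (n : ℝ) ^ 2 + 8 * (n : ℝ) + 25 / (n : ℝ) - 32 ≤ B := by
    rw [e2, ← sub_nonpos, diff 2]
    exact mul_nonpos_of_nonpos_of_nonneg (by linarith) (pos 2 (by norm_num)).le
  have lowe : B = (n : ℝ) ^ 2 + 8 * (n : ℝ) + 25 / (n : ℝ) - 32 ↔ t = 2 := by
    rw [e2, eqc 2 (by norm_num)]; norm_cast
  refine ⟨rfl, fun _ => ⟨low, ?_, lowe, ?_⟩, fun hev => ⟨low, ?_, lowe, ?_⟩⟩
  · rw [eo]; apply lec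
    have : 2 * t + 1 ≤ n := by omega
    have : (2 * t + 1 : ℝ) ≤ n := by exact_mod_cast this
    linarith
  · rw [eo, eqc _ (by linarith)]
    constructor
    · intro h
      have : (n : ℝ) = 2 * t + 1 := by linarith
      exact_mod_cast this
    · intro h
      have : (n : ℝ) = 2 * t + 1 := by exact_mod_cast h
      linarith
  · rw [ee]; apply lec
    have : 2 * t + 2 ≤ n := by
      obtain ⟨m, hm⟩ := hev
      omega
    have : (2 * t + 2 : ℝ) ≤ n := by exact_mod_cast this
    linarith
  · rw [ee, eqc _ (by linarith)]
    constructor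
    · intro h
      have : (n : ℝ) = 2 * t + 2 := by linarith
      exact_mod_cast this
    · intro h
      have : (n : ℝ) = 2 * t + 2 := by exact_mod_cast h
      linarith
end

section
/- Let F_{s,t,n−2s−2t−1} be the firefly graph with s ≥ 1 triangles, t ≥ 1 pendant paths of length 2, and n − 2s − 2t − 1 ≥ 0 pendant edges, on n ≥ 7 vertices. Then BH(F_{s,t,n−2s−2t−1}) = n² − (8/9)sn − 2n + (9t² + (5n² − 16n − 6)t + 1)/n. Consequently: if n is odd then 5n²/9 + 13n/3 + 4/n − 16 ≤ BH(F_{s,t,n−2s−2t−1}) ≤ 7n²/2 − 581n/36 + 121/(4n) + 15/2, with the lower bound attained exactly at (s,t) = ((n−3)/2, 1) and the upper bound exactly at (s,t) = (1, (n−3)/2); if n is even then 5n²/9 + 43n/9 + 4/n − 16 ≤ BH(F_{s,t,n−2s−2t−1}) ≤ 7n²/2 − 671n/36 + 49/n + 11, with the lower bound attained exactly at (s,t) = ((n−4)/2, 1) and the upper bound exactly at (s,t) = (1, (n−4)/2). -/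
open Finset Polynomial

abbrev FV (s t k : ℕ) := Unit ⊕ ((Fin 2 × Fin s) ⊕ ((Fin 2 × Fin t) ⊕ Fin k))

def fvMap (s t k : ℕ) : FV s t k → Fin (2 * s + 2 * t + k + 1)
  | .inl _ => ⟨0, by omega⟩
  | .inr (.inl (b, i)) => ⟨2 * i.val + 1 + b.val, by omega⟩
  | .inr (.inr (.inl (b, i))) => ⟨2 * s + 2 * i.val + 1 + b.val, by omega⟩
  | .inr (.inr (.inr i)) => ⟨2 * s + 2 * t + 1 + i.val, by omega⟩

theorem fvMap_bij (s t k : ℕ) : Function.Bijective (fvMap s t k) := by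
  rw [Fintype.bijective_iff_injective_and_card]
  constructor
  · rintro (a | ⟨b, i⟩ | ⟨b, i⟩ | i) (a' | ⟨b', i'⟩ | ⟨b', i'⟩ | i') h <;>
      simp only [fvMap, Fin.mk.injEq] at h <;>
      simp only [Sum.inl.injEq, Sum.inr.injEq, Prod.mk.injEq, Fin.ext_iff, reduceCtorEq] <;> omega
  · simp; ring

def fvAdj (s t k : ℕ) : FV s t k → FV s t k → ℝ
  | .inl _, .inl _ => 0
  | .inl _, .inr (.inl _) => 1
  | .inl _, .inr (.inr (.inl (b, _))) => if b = 0 then 1 else 0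
  | .inl _, .inr (.inr (.inr _)) => 1
  | .inr (.inl _), .inl _ => 1
  | .inr (.inr (.inl (b, _))), .inl _ => if b = 0 then 1 else 0
  | .inr (.inr (.inr _)), .inl _ => 1
  | .inr (.inl (b, i)), .inr (.inl (b', i')) => if i = i' then (if b = b' then 0 else 1) else 0
  | .inr (.inr (.inl (b, i))), .inr (.inr (.inl (b', i'))) =>
      if i = i' then (if b = b' then 0 else 1) else 0
  | .inr _, .inr _ => 0

theorem fvAdj_eq (s t k : ℕ) (u v : FV s t k) :
    (if (firefly s t k).Adj (fvMap s t k u) (fvMap s t k v) then (1 : ℝ) else 0) = fvAdj s t k u v := by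
  obtain (a | ⟨b, i⟩ | ⟨b, i⟩ | i) := u <;> obtain (a' | ⟨b', i'⟩ | ⟨b', i'⟩ | i') := v <;>
    simp only [fvMap, fvAdj, firefly, SimpleGraph.fromRel_adj, ne_eq, Fin.ext_iff, Nat.odd_iff] <;>
    (try simp only [Fin.isValue, Fin.val_zero]) <;> 
    split_ifs <;> first | rfl | (exfalso; omega) | (exfalso; simp only [true_and, false_and, and_false, false_or, or_false, not_true_eq_false, not_false_eq_true] at * <;> omega)

theorem fvLap_eq (s t k : ℕ) (u v : FV s t k) :
    (firefly s t k).lapMatrix ℝ (fvMap s t k u) (fvMap s t k v) =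
      (if u = v then ∑ w, fvAdj s t k u w else 0) - fvAdj s t k u v := by
  rw [SimpleGraph.lapMatrix, Matrix.sub_apply, SimpleGraph.degMatrix, Matrix.diagonal_apply,
    SimpleGraph.adjMatrix_apply, fvAdj_eq, SimpleGraph.degree_eq_sum_if_adj,
    ← (fvMap_bij s t k).sum_comp]
  simp only [fvAdj_eq, (fvMap_bij s t k).1.eq_iff]

theorem fvDeg_c (s t k : ℕ) (a : Unit) : ∑ w, fvAdj s t k (.inl a) w = 2 * s + t + k := by
  simp only [Fintype.sum_sum_type, Fintype.sum_prod_type, fvAdj, Fin.sum_univ_two]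
  simp; ring

theorem fvDeg_tri (s t k : ℕ) (b i) : ∑ w, fvAdj s t k (.inr (.inl (b, i))) w = 2 := by
  fin_cases b <;>
  simp [Fintype.sum_sum_type, Fintype.sum_prod_type, fvAdj, Fin.sum_univ_two] <;> norm_num

theorem fvDeg_path (s t k : ℕ) (b i) : ∑ w, fvAdj s t k (.inr (.inr (.inl (b, i)))) w =
    if b = 0 then 2 else 1 := by
  fin_cases b <;>
  simp [Fintype.sum_sum_type, Fintype.sum_prod_type, fvAdj, Fin.sum_univ_two] <;> norm_num

theorem fvDeg_pend (s t k : ℕ) (i) : ∑ w, fvAdj s t k (.inr (.inr (.inr i))) w = 1 := by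
  simp [Fintype.sum_sum_type, Fintype.sum_prod_type, fvAdj, Fin.sum_univ_two]

def fvD (s t k : ℕ) (x : ℝ) :
    Matrix ((Fin 2 × Fin s) ⊕ ((Fin 2 × Fin t) ⊕ Fin k)) ((Fin 2 × Fin s) ⊕ ((Fin 2 × Fin t) ⊕ Fin k)) ℝ :=
  Matrix.fromBlocks (Matrix.blockDiagonal fun _ => !![x - 2, 1; 1, x - 2]) 0 0
    (Matrix.fromBlocks (Matrix.blockDiagonal fun _ => !![x - 2, 1; 1, x - 1]) 0 0
      (Matrix.diagonal fun _ => x - 1))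

theorem fvD_det (s t k : ℕ) (x : ℝ) : (fvD s t k x).det =
    ((x - 1) * (x - 3)) ^ s * ((x ^ 2 - 3 * x + 1) ^ t * (x - 1) ^ k) := by
  simp only [fvD, Matrix.det_fromBlocks_zero₂₁, Matrix.det_blockDiagonal, Matrix.det_diagonal,
    Matrix.det_fin_two_of, Finset.prod_const, Finset.card_univ, Fintype.card_fin]
  congr 2
  · ring
  · congr 1; ring

def fvC (s t k : ℕ) : (Fin 2 × Fin s) ⊕ ((Fin 2 × Fin t) ⊕ Fin k) → ℝ
  | .inl _ => 1
  | .inr (.inl (b, _)) => if b = 0 then 1 else 0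
  | .inr (.inr _) => 1

noncomputable def fvW (s t k : ℕ) (x : ℝ) : (Fin 2 × Fin s) ⊕ ((Fin 2 × Fin t) ⊕ Fin k) → ℝ
  | .inl _ => 1 / (x - 1)
  | .inr (.inl (b, _)) => if b = 0 then (x - 1) / (x ^ 2 - 3 * x + 1) else -1 / (x ^ 2 - 3 * x + 1)
  | .inr (.inr _) => 1 / (x - 1)

theorem fvM_eq (s t k : ℕ) (x : ℝ) :
    (Matrix.scalar _ x - (firefly s t k).lapMatrix ℝ).submatrix (fvMap s t k) (fvMap s t k) =
    Matrix.fromBlocks (Matrix.of fun _ _ : Unit => x - (2 * s + t + k))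
      (Matrix.of fun _ j => fvC s t k j) (Matrix.of fun j _ => fvC s t k j) (fvD s t k x) := by
  ext u v
  rw [Matrix.submatrix_apply, Matrix.sub_apply, fvLap_eq, Matrix.scalar_apply, Matrix.diagonal_apply]
  simp only [(fvMap_bij s t k).1.eq_iff]
  obtain (a | ⟨b, i⟩ | ⟨b, i⟩ | i) := u <;> obtain (a' | ⟨b', i'⟩ | ⟨b', i'⟩ | i') := v <;>
  simp only [fvDeg_c, fvDeg_tri, fvDeg_path, fvDeg_pend]
  · simp [fvAdj]
  · simp [fvAdj, fvC]
  · simp [fvAdj, fvC]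
  · simp [fvAdj, fvC]
  · simp [fvAdj, fvC]
  · by_cases h : i = i'
    · subst h; fin_cases b <;> fin_cases b' <;> simp [fvAdj, fvD]
    · simp [fvAdj, fvD, h, Matrix.blockDiagonal_apply]
  · simp [fvAdj, fvD]
  · simp [fvAdj, fvD]
  · simp [fvAdj, fvC]
  · simp [fvAdj, fvD]
  · by_cases h : i = i'
    · subst h; fin_cases b <;> fin_cases b' <;> simp [fvAdj, fvD]
    · simp [fvAdj, fvD, h, Matrix.blockDiagonal_apply]
  · simp [fvAdj, fvD]
  · simp [fvAdj, fvC]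
  · simp [fvAdj, fvD]
  · simp [fvAdj, fvD]
  · by_cases h : i = i'
    · subst h; simp [fvAdj, fvD]
    · simp [fvAdj, fvD, h]

theorem fvDW (s t k : ℕ) (x : ℝ) (h1 : x - 1 ≠ 0) (h2 : x ^ 2 - 3 * x + 1 ≠ 0) :
    (fvD s t k x).mulVec (fvW s t k x) = fvC s t k := by
  ext u
  obtain (⟨b, i⟩ | ⟨b, i⟩ | i) := u
  · fin_cases b <;>
    simp [Matrix.mulVec, dotProduct, fvD, fvW, fvC, Fintype.sum_sum_type, Fintype.sum_prod_type, Fin.sum_univ_two, Matrix.blockDiagonal_apply, Matrix.diagonal_apply] <;> field_simp <;> ring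
  · fin_cases b <;>
    simp [Matrix.mulVec, dotProduct, fvD, fvW, fvC, Fintype.sum_sum_type, Fintype.sum_prod_type, Fin.sum_univ_two, Matrix.blockDiagonal_apply, Matrix.diagonal_apply]
    · rw [← mul_div_assoc, ← add_div, div_eq_one_iff_eq h2]; ring
    · field_simp; ring
  · simp [Matrix.mulVec, dotProduct, fvD, fvW, fvC, Fintype.sum_sum_type, Fintype.sum_prod_type, Fin.sum_univ_two, Matrix.blockDiagonal_apply, Matrix.diagonal_apply]; field_simp

theorem fv_charpoly_eval (s t k : ℕ) (x : ℝ) (h1 : x - 1 ≠ 0) (h2 : x ^ 2 - 3 * x + 1 ≠ 0) :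
    ((firefly s t k).lapMatrix ℝ).charpoly.eval x =
    (x - (2 * s + t + k) - (2 * s / (x - 1) + t * ((x - 1) / (x ^ 2 - 3 * x + 1)) + k / (x - 1))) *
    (((x - 1) * (x - 3)) ^ s * ((x ^ 2 - 3 * x + 1) ^ t * (x - 1) ^ k)) := by
  rw [Matrix.eval_charpoly, ← Matrix.det_submatrix_equiv_self (Equiv.ofBijective _ (fvMap_bij s t k))]
  change ((Matrix.scalar _ x - (firefly s t k).lapMatrix ℝ).submatrix (fvMap s t k) (fvMap s t k)).det = _
  rw [fvM_eq]
  set M := Matrix.fromBlocks (Matrix.of fun _ _ : Unit => x - (2 * s + t + k))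
      (Matrix.of fun _ j => fvC s t k j) (Matrix.of fun j _ => fvC s t k j) (fvD s t k x) with hM
  have hE : (Matrix.fromBlocks (1 : Matrix Unit Unit ℝ) 0 (Matrix.of fun j _ => - fvW s t k x j) 1).det = 1 := by
    rw [Matrix.det_fromBlocks_zero₁₂]; simp
  have hDW := fvDW s t k x h1 h2
  have hP : M * (Matrix.fromBlocks (1 : Matrix Unit Unit ℝ) 0 (Matrix.of fun j _ => - fvW s t k x j) 1)
    = Matrix.fromBlocks (Matrix.of fun _ _ : Unit => x - (2 * s + t + k) - ∑ j, fvC s t k j * fvW s t k x j)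
      (Matrix.of fun _ j => fvC s t k j) 0 (fvD s t k x) := by
    rw [hM, Matrix.fromBlocks_multiply]
    congr 1
    · ext i j; simp [Matrix.mul_apply, sub_eq_add_neg]
    · simp
    · ext i j
      have := congrFun hDW i
      simp only [Matrix.mulVec, dotProduct] at this
      simp [Matrix.mul_apply, this]
    · simp
  have := congrArg Matrix.det hP
  rw [Matrix.det_mul, hE, mul_one, Matrix.det_fromBlocks_zero₂₁, fvD_det, Matrix.det_unique (n := Unit)] at this
  rw [this]
  congr 1
  rw [Matrix.of_apply]
  congr 1
  simp only [fvW, fvC, Fintype.sum_sum_type, Fintype.sum_prod_type, Fin.sum_univ_two]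
  simp
  ring

noncomputable def fvCub (s t k : ℕ) : Cubic ℝ :=
  ⟨1, -(2 * s + t + k + 4), 3 * (2 * s + t + k) + 4, -(2 * s + 2 * t + k + 1)⟩

theorem fv_charpoly (s t k : ℕ) :
    ((firefly (s+1) (t+1) k).lapMatrix ℝ).charpoly =
    X * (X - C 3) ^ (s + 1) * (X - C 1) ^ (s + k) * (X ^ 2 - C 3 * X + C 1) ^ t *
      (fvCub (s+1) (t+1) k).toPoly := by
  apply Polynomial.eq_of_infinite_eval_eq
  refine (Set.Ioi_infinite (3 : ℝ)).mono ?_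
  intro x hx
  have hx : 3 < x := hx
  have h1 : x - 1 ≠ 0 := by intro h; linarith
  have h2 : x ^ 2 - 3 * x + 1 ≠ 0 := by intro h; nlinarith
  simp only [Set.mem_setOf_eq]
  rw [fv_charpoly_eval _ _ _ _ h1 h2]
  simp only [fvCub, Cubic.toPoly, eval_mul, eval_pow, eval_sub, eval_add, eval_X, eval_C, mul_pow]
  have e1 : (x - 1) ^ (s + 1) * (x - 1) ^ k = (x - 1) ^ (s + k) * (x - 1) := by ring
  have e2 : (x ^ 2 - 3 * x + 1) ^ (t + 1) = (x ^ 2 - 3 * x + 1) ^ t * (x ^ 2 - 3 * x + 1) := by ring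
  push_cast
  generalize hq : (x ^ 2 - 3 * x + 1) ^ t = Q at *
  generalize hp : (x - 1) ^ (s + k) = P at *
  rw [e2]
  generalize (x - 3) ^ (s + 1) = R at *
  calc _ = (x - (2 * (s + 1) + (t + 1) + k) - (2 * (s + 1) / (x - 1) + (t + 1) * ((x - 1) / (x ^ 2 - 3 * x + 1)) + k / (x - 1))) * R * Q * (x ^ 2 - 3 * x + 1) * ((x - 1) ^ (s + 1) * (x - 1) ^ k) := by ring
    _ = _ := by
      rw [e1, div_eq_mul_inv _ (x - 1), div_eq_mul_inv _ (x - 1)]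
      have hu : (x - 1)⁻¹ * (x - 1) = 1 := inv_mul_cancel₀ h1
      have hv : (x - 1) / (x ^ 2 - 3 * x + 1) * (x ^ 2 - 3 * x + 1) = x - 1 := div_mul_cancel₀ _ h2
      generalize (x - 1)⁻¹ = u at *
      generalize (x - 1) / (x ^ 2 - 3 * x + 1) = v at *
      linear_combination (-(R * Q * P * (x ^ 2 - 3 * x + 1) * (2 * (s + 1) + k))) * hu
        - ((t + 1) * R * Q * P * (x - 1)) * hv

theorem fv_quad : ∃ a b : ℝ, a + b = 3 ∧ a * b = 1 := by
  refine ⟨(3 + √5) / 2, (3 - √5) / 2, by ring, ?_⟩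
  have := Real.mul_self_sqrt (show (0 : ℝ) ≤ 5 by norm_num)
  linarith

theorem fv_roots_sum (s t k : ℕ) :
    ((((firefly (s+1) (t+1) k).lapMatrix ℝ).charpoly.roots).map (fun x : ℝ => 1 / x ^ 2)).sum =
    ((s : ℝ) + 1) / 9 + (s + k) + 7 * t +
      (((3 * (2 * ((s : ℝ) + 1) + (t + 1) + k) + 4) / (2 * (s + 1) + 2 * (t + 1) + k + 1)) ^ 2
        - 2 * (2 * (s + 1) + (t + 1) + k + 4) / (2 * (s + 1) + 2 * (t + 1) + k + 1)) := by
  set p := ((firefly (s+1) (t+1) k).lapMatrix ℝ).charpoly with hp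
  have hsp : p.Splits := (SimpleGraph.posSemidef_lapMatrix (R := ℝ) (G := firefly (s+1) (t+1) k)).1.splits_charpoly
  have hp0 : p ≠ 0 := (Matrix.charpoly_monic _).ne_zero
  have hfac := fv_charpoly s t k
  rw [← hp] at hfac
  have hcs : (fvCub (s+1) (t+1) k).toPoly.Splits := hsp.of_dvd hp0 (by rw [hfac]; exact dvd_mul_left _ _)
  have ha : (fvCub (s+1) (t+1) k).a ≠ 0 := by simp [fvCub]
  have hcs' : ((fvCub (s+1) (t+1) k).toPoly.map (RingHom.id ℝ)).Splits := by simpa using hcs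
  obtain ⟨x, y, z, h3⟩ := (Cubic.splits_iff_roots_eq_three ha).1 hcs'
  have hb := Cubic.b_eq_three_roots ha h3
  have hc := Cubic.c_eq_three_roots ha h3
  have hd := Cubic.d_eq_three_roots ha h3
  rw [Cubic.map_roots, Polynomial.map_id] at h3
  simp only [fvCub, RingHom.id_apply] at hb hc hd
  push_cast at hb hc hd
  obtain ⟨a, b, hab, hab1⟩ := fv_quad
  have hq : (X ^ 2 - C 3 * X + C 1 : ℝ[X]) = (X - C a) * (X - C b) := by
    rw [← hab, ← hab1]; simp only [C_add, C_mul]; ring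
  rw [hq] at hfac
  rw [hfac] at hp0 ⊢
  rw [Polynomial.roots_mul hp0]
  have hp1 := left_ne_zero_of_mul hp0
  rw [Polynomial.roots_mul hp1]
  have hp2 := left_ne_zero_of_mul hp1
  rw [Polynomial.roots_mul hp2]
  have hp3 := left_ne_zero_of_mul hp2
  rw [Polynomial.roots_mul hp3, h3, Polynomial.roots_pow, Polynomial.roots_pow, Polynomial.roots_pow,
    Polynomial.roots_mul (mul_ne_zero (X_sub_C_ne_zero a) (X_sub_C_ne_zero b))]
  simp only [roots_X, roots_X_sub_C, Multiset.map_add, Multiset.sum_add, Multiset.map_nsmul,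
    Multiset.sum_nsmul, Multiset.map_singleton, Multiset.sum_singleton, Multiset.insert_eq_cons,
    Multiset.map_cons, Multiset.sum_cons, nsmul_eq_mul]
  have hN : (2 * ((s:ℝ) + 1) + 2 * (t + 1) + k + 1) ≠ 0 := by positivity
  have hxyz : x * y * z = 2 * ((s:ℝ) + 1) + 2 * (t + 1) + k + 1 := by linarith
  have hx : x ≠ 0 := by rintro rfl; apply hN; rw [← hxyz]; ring
  have hy : y ≠ 0 := by rintro rfl; apply hN; rw [← hxyz]; ring
  have hz : z ≠ 0 := by rintro rfl; apply hN; rw [← hxyz]; ring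
  have h1 : 1 / a ^ 2 + 1 / b ^ 2 = 7 := by
    have ha0 : a ≠ 0 := by rintro rfl; simp at hab1
    have hb0 : b ≠ 0 := by rintro rfl; simp at hab1
    have e1 : 1 / a = b := by field_simp; linarith
    have e2 : 1 / b = a := by field_simp; linarith
    rw [← one_div_pow, ← one_div_pow, e1, e2]
    nlinarith
  have h2 : 1 / x ^ 2 + (1 / y ^ 2 + 1 / z ^ 2) =
     (((3 * (2 * ((s:ℝ) + 1) + (t + 1) + k) + 4) / (2 * (s + 1) + 2 * (t + 1) + k + 1)) ^ 2
        - 2 * (2 * (s + 1) + (t + 1) + k + 4) / (2 * (s + 1) + 2 * (t + 1) + k + 1)) := by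
    rw [← hxyz, hc, show 2 * ((s:ℝ) + 1) + (t + 1) + k + 4 = x + y + z by linarith]
    field_simp
    ring
  rw [h1, h2]
  push_cast
  norm_num
  ring

theorem fv_sum {s t k : ℕ} (μ : Fin (2 * s + 2 * t + k + 1) → ℝ)
    (hμ : IsLapEigSeq (firefly s t k) μ) :
    ∑ i ∈ univ.filter (fun i : Fin (2 * s + 2 * t + k + 1) => 0 < i.val), 1 / μ i ^ 2 =
    ((((firefly s t k).lapMatrix ℝ).charpoly.roots).map (fun x : ℝ => 1 / x ^ 2)).sum := by
  obtain ⟨hm, e, he⟩ := hμ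
  have hps := SimpleGraph.posSemidef_lapMatrix (R := ℝ) (G := firefly s t k)
  have hnn : ∀ i, 0 ≤ μ i := by
    intro i
    have := he (e.symm i)
    rw [Equiv.apply_symm_apply] at this
    rw [← this]
    exact hps.eigenvalues_nonneg _
  have hz : ∃ i, μ i = 0 := by
    have hd := SimpleGraph.det_lapMatrix_eq_zero (G := firefly s t k)
    rw [hps.1.det_eq_prod_eigenvalues, Finset.prod_eq_zero_iff] at hd
    obtain ⟨v, -, hv⟩ := hd
    refine ⟨e v, ?_⟩
    rw [← he v]
    unfold lapEigsUnordered
    simpa using hv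
  have h0 : μ 0 = 0 := by
    obtain ⟨i, hi⟩ := hz
    exact le_antisymm (hi ▸ hm (Fin.zero_le i)) (hnn 0)
  rw [hps.1.roots_charpoly_eq_eigenvalues, Multiset.map_map]
  change _ = ∑ v, 1 / (lapEigsUnordered (firefly s t k) v) ^ 2
  simp only [he]
  rw [e.sum_comp (fun i => 1 / μ i ^ 2)]
  apply Finset.sum_subset (Finset.filter_subset _ _)
  intro i _ hi
  have : i = 0 := by
    simp only [mem_filter, mem_univ, true_and, not_lt] at hi
    ext; simpa using hi
  rw [this, h0]; simp

theorem fv_formula {n s t k : ℕ} (hs : 1 ≤ s) (ht : 1 ≤ t)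
    (hk : n = 2 * s + 2 * t + k + 1)
    (μ : Fin (2 * s + 2 * t + k + 1) → ℝ) (hμ : IsLapEigSeq (firefly s t k) μ) :
    (n : ℝ) * ∑ i ∈ univ.filter (fun i : Fin (2 * s + 2 * t + k + 1) => 0 < i.val), 1 / μ i ^ 2 = (n : ℝ) ^ 2 - (8 / 9) * (s : ℝ) * (n : ℝ) - 2 * (n : ℝ) + (9 * (t : ℝ) ^ 2 + (5 * (n : ℝ) ^ 2 - 16 * (n : ℝ) - 6) * (t : ℝ) + 1) / (n : ℝ) := by
  rw [fv_sum μ hμ]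
  obtain ⟨s, rfl⟩ := Nat.exists_eq_add_of_le' hs
  obtain ⟨t, rfl⟩ := Nat.exists_eq_add_of_le' ht
  rw [fv_roots_sum]
  have hn0 : (n : ℝ) ≠ 0 := by
    have : n ≠ 0 := by omega
    exact_mod_cast this
  have hN : (n : ℝ) = 2 * (s + 1) + 2 * (t + 1) + k + 1 := by rw [hk]; push_cast; ring
  have hkk : (k : ℝ) = n - 2 * (s + 1) - 2 * (t + 1) - 1 := by linarith
  rw [← hN, hkk]
  push_cast
  field_simp
  ring

theorem fv_lower (s t r n : ℝ) (hs : 1 ≤ s) (ht : 1 ≤ t) (hst : s + t ≤ r + 1) (hn : 7 ≤ n) :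
    let F := fun s t : ℝ => n ^ 2 - (8 / 9) * s * n - 2 * n + (9 * t ^ 2 + (5 * n ^ 2 - 16 * n - 6) * t + 1) / n
    F r 1 ≤ F s t ∧ F s t ≤ F 1 r ∧ (F s t = F r 1 ↔ s = r ∧ t = 1) ∧ (F s t = F 1 r ↔ s = 1 ∧ t = r) := by
  intro F
  have hn0 : 0 < n := by linarith
  have e1 : F s t - F r 1 = (8 / 9) * n * (r - s) + (t - 1) * ((9 * (t + 1) + (5 * n ^ 2 - 16 * n - 6)) / n) := by
    simp only [F]; field_simp; ring
  have e2 : F 1 r - F s t = (8 / 9) * n * (s - 1) + (r - t) * ((9 * (r + t) + (5 * n ^ 2 - 16 * n - 6)) / n) := by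
    simp only [F]; field_simp; ring
  have p1 : 0 < (9 * (t + 1) + (5 * n ^ 2 - 16 * n - 6)) / n := by
    apply div_pos _ hn0; nlinarith
  have p2 : 0 < (9 * (r + t) + (5 * n ^ 2 - 16 * n - 6)) / n := by
    apply div_pos _ hn0; nlinarith
  generalize (9 * (t + 1) + (5 * n ^ 2 - 16 * n - 6)) / n = P1 at *
  generalize (9 * (r + t) + (5 * n ^ 2 - 16 * n - 6)) / n = P2 at *
  have a1 : 0 ≤ (8 / 9) * n * (r - s) := mul_nonneg (by positivity) (by linarith)
  have a2 : 0 ≤ (t - 1) * P1 := mul_nonneg (by linarith) p1.le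
  have a3 : 0 ≤ (8 / 9) * n * (s - 1) := mul_nonneg (by positivity) (by linarith)
  have a4 : 0 ≤ (r - t) * P2 := mul_nonneg (by linarith) p2.le
  refine ⟨by linarith, by linarith, ⟨fun h => ?_, ?_⟩, ⟨fun h => ?_, ?_⟩⟩
  · have b1 : (8 / 9) * n * (r - s) = 0 := by linarith
    have b2 : (t - 1) * P1 = 0 := by linarith
    rcases mul_eq_zero.1 b1 with h | h
    · linarith
    rcases mul_eq_zero.1 b2 with h' | h'
    · exact ⟨by linarith, by linarith⟩
    · linarith
  · rintro ⟨rfl, rfl⟩; rfl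
  · have b1 : (8 / 9) * n * (s - 1) = 0 := by linarith
    have b2 : (r - t) * P2 = 0 := by linarith
    rcases mul_eq_zero.1 b1 with h | h
    · linarith
    rcases mul_eq_zero.1 b2 with h' | h'
    · exact ⟨by linarith, by linarith⟩
    · linarith
  · rintro ⟨rfl, rfl⟩; rfl

theorem statement_15 {n s t k : ℕ} (hn : 7 ≤ n) (hs : 1 ≤ s) (ht : 1 ≤ t)
    (hk : n = 2 * s + 2 * t + k + 1)
    (μ : Fin (2 * s + 2 * t + k + 1) → ℝ) (hμ : IsLapEigSeq (firefly s t k) μ) :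
    (n : ℝ) * ∑ i ∈ univ.filter (fun i : Fin (2 * s + 2 * t + k + 1) => 0 < i.val), 1 / μ i ^ 2 = (n : ℝ) ^ 2 - (8 / 9) * (s : ℝ) * (n : ℝ) - 2 * (n : ℝ) + (9 * (t : ℝ) ^ 2 + (5 * (n : ℝ) ^ 2 - 16 * (n : ℝ) - 6) * (t : ℝ) + 1) / (n : ℝ) ∧
    (Odd n →
      (5 * (n : ℝ) ^ 2 / 9 + 13 * (n : ℝ) / 3 + 4 / (n : ℝ) - 16 ≤ (n : ℝ) * ∑ i ∈ univ.filter (fun i : Fin (2 * s + 2 * t + k + 1) => 0 < i.val), 1 / μ i ^ 2 ∧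
       (n : ℝ) * ∑ i ∈ univ.filter (fun i : Fin (2 * s + 2 * t + k + 1) => 0 < i.val), 1 / μ i ^ 2 ≤ 7 * (n : ℝ) ^ 2 / 2 - 581 * (n : ℝ) / 36 + 121 / (4 * (n : ℝ)) + 15 / 2 ∧
       ((n : ℝ) * ∑ i ∈ univ.filter (fun i : Fin (2 * s + 2 * t + k + 1) => 0 < i.val), 1 / μ i ^ 2 = 5 * (n : ℝ) ^ 2 / 9 + 13 * (n : ℝ) / 3 + 4 / (n : ℝ) - 16 ↔ n = 2 * s + 3 ∧ t = 1) ∧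
       ((n : ℝ) * ∑ i ∈ univ.filter (fun i : Fin (2 * s + 2 * t + k + 1) => 0 < i.val), 1 / μ i ^ 2 = 7 * (n : ℝ) ^ 2 / 2 - 581 * (n : ℝ) / 36 + 121 / (4 * (n : ℝ)) + 15 / 2 ↔ s = 1 ∧ n = 2 * t + 3))) ∧
    (Even n →
      (5 * (n : ℝ) ^ 2 / 9 + 43 * (n : ℝ) / 9 + 4 / (n : ℝ) - 16 ≤ (n : ℝ) * ∑ i ∈ univ.filter (fun i : Fin (2 * s + 2 * t + k + 1) => 0 < i.val), 1 / μ i ^ 2 ∧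
       (n : ℝ) * ∑ i ∈ univ.filter (fun i : Fin (2 * s + 2 * t + k + 1) => 0 < i.val), 1 / μ i ^ 2 ≤ 7 * (n : ℝ) ^ 2 / 2 - 671 * (n : ℝ) / 36 + 49 / (n : ℝ) + 11 ∧
       ((n : ℝ) * ∑ i ∈ univ.filter (fun i : Fin (2 * s + 2 * t + k + 1) => 0 < i.val), 1 / μ i ^ 2 = 5 * (n : ℝ) ^ 2 / 9 + 43 * (n : ℝ) / 9 + 4 / (n : ℝ) - 16 ↔ n = 2 * s + 4 ∧ t = 1) ∧
       ((n : ℝ) * ∑ i ∈ univ.filter (fun i : Fin (2 * s + 2 * t + k + 1) => 0 < i.val), 1 / μ i ^ 2 = 7 * (n : ℝ) ^ 2 / 2 - 671 * (n : ℝ) / 36 + 49 / (n : ℝ) + 11 ↔ s = 1 ∧ n = 2 * t + 4))) := by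
  have hF := fv_formula hs ht hk μ hμ
  rw [hF]
  have hn0 : (n : ℝ) ≠ 0 := by
    have : n ≠ 0 := by omega
    exact_mod_cast this
  refine ⟨rfl, ?_, ?_⟩
  · rintro ⟨m, hm⟩
    obtain ⟨r, hr⟩ : ∃ r, n = 2 * r + 3 := ⟨(n - 3) / 2, by omega⟩
    have hrn : (n : ℝ) = 2 * r + 3 := by rw [hr]; push_cast; ring
    have hst : s + t ≤ r + 1 := by omega
    obtain ⟨g1, g2, g3, g4⟩ := fv_lower (s : ℝ) t r n (by exact_mod_cast hs) (by exact_mod_cast ht)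
      (by exact_mod_cast hst) (by exact_mod_cast hn)
    have hr' : (r : ℝ) = (n - 3) / 2 := by linarith
    have i1 : (n = 2 * s + 3 ∧ t = 1) ↔ ((s : ℝ) = r ∧ (t : ℝ) = 1) := by
      rw [Nat.cast_inj, Nat.cast_eq_one]; omega
    have i2 : (s = 1 ∧ n = 2 * t + 3) ↔ ((s : ℝ) = 1 ∧ (t : ℝ) = r) := by
      rw [Nat.cast_inj, Nat.cast_eq_one]; omega
    rw [i1, i2, ← g3, ← g4]
    have q1 : 5 * (n : ℝ) ^ 2 / 9 + 13 * (n : ℝ) / 3 + 4 / (n : ℝ) - 16 = (n : ℝ) ^ 2 - (8 / 9) * (r : ℝ) * n - 2 * n + (9 * 1 ^ 2 + (5 * (n : ℝ) ^ 2 - 16 * n - 6) * 1 + 1) / n := by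
      rw [hr']; field_simp; ring
    have q2 : 7 * (n : ℝ) ^ 2 / 2 - 581 * (n : ℝ) / 36 + 121 / (4 * (n : ℝ)) + 15 / 2 = (n : ℝ) ^ 2 - (8 / 9) * 1 * n - 2 * n + (9 * (r : ℝ) ^ 2 + (5 * (n : ℝ) ^ 2 - 16 * n - 6) * r + 1) / n := by
      rw [hr']; field_simp; ring
    rw [q1, q2]
    exact ⟨g1, g2, Iff.rfl, Iff.rfl⟩
  · rintro ⟨m, hm⟩
    obtain ⟨r, hr⟩ : ∃ r, n = 2 * r + 4 := ⟨(n - 4) / 2, by omega⟩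
    have hrn : (n : ℝ) = 2 * r + 4 := by rw [hr]; push_cast; ring
    have hst : s + t ≤ r + 1 := by omega
    obtain ⟨g1, g2, g3, g4⟩ := fv_lower (s : ℝ) t r n (by exact_mod_cast hs) (by exact_mod_cast ht)
      (by exact_mod_cast hst) (by exact_mod_cast hn)
    have hr' : (r : ℝ) = (n - 4) / 2 := by linarith
    have i1 : (n = 2 * s + 4 ∧ t = 1) ↔ ((s : ℝ) = r ∧ (t : ℝ) = 1) := by
      rw [Nat.cast_inj, Nat.cast_eq_one]; omega
    have i2 : (s = 1 ∧ n = 2 * t + 4) ↔ ((s : ℝ) = 1 ∧ (t : ℝ) = r) := by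
      rw [Nat.cast_inj, Nat.cast_eq_one]; omega
    rw [i1, i2, ← g3, ← g4]
    have q1 : 5 * (n : ℝ) ^ 2 / 9 + 43 * (n : ℝ) / 9 + 4 / (n : ℝ) - 16 = (n : ℝ) ^ 2 - (8 / 9) * (r : ℝ) * n - 2 * n + (9 * 1 ^ 2 + (5 * (n : ℝ) ^ 2 - 16 * n - 6) * 1 + 1) / n := by
      rw [hr']; field_simp; ring
    have q2 : 7 * (n : ℝ) ^ 2 / 2 - 671 * (n : ℝ) / 36 + 49 / (n : ℝ) + 11 = (n : ℝ) ^ 2 - (8 / 9) * 1 * n - 2 * n + (9 * (r : ℝ) ^ 2 + (5 * (n : ℝ) ^ 2 - 16 * n - 6) * r + 1) / n := by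
      rw [hr']; field_simp; ring
    rw [q1, q2]
    exact ⟨g1, g2, Iff.rfl, Iff.rfl⟩
end
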